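/- arXiv:1806.09854 — 2 statements merged into one kernel-verified Lean document; each statement's English description precedes it below -/
import Mathlib

section
/- Let 0 < p < ∞, let ω ∈ D be a radial weight, let α = α(ω) > 0 be a Ď-exponent of ω (i.e. there is C₀ > 0 with ω̂(t) ≤ C₀((1−t)/(1−r))^α ω̂(r) for all 0 ≤ r ≤ t < 1), and let κ > −α. Then there exists C ≥ 1 such that for every analytic function f on 𝔻: C^{-1} ∫_𝔻 |f(z)|^p (1−|z|)^{κ−1} ω̂(z) dA(z) ≤ ∫_𝔻 |f(z)|^p (1−|z|)^κ ω(z) dA(z) ≤ C ∫_𝔻 |f(z)|^p (1−|z|)^{κ−1} ω̂(z) dA(z). -/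
open MeasureTheory Set
open scoped ENNReal ComplexConjugate

noncomputable section

/-- The open unit disc in `ℂ`. -/
def UD : Set ℂ := Metric.ball (0 : ℂ) 1

/-- Normalized area measure `dA = dx dy / π` on `ℂ`. -/
def dA : Measure ℂ := (ENNReal.ofReal Real.pi)⁻¹ • (MeasureTheory.volume : Measure ℂ)

/-- `ω̂(r) = ∫_r^1 ω(s) ds` for a (radial) weight `ω : ℂ → ℝ`. -/
def what (ω : ℂ → ℝ) (r : ℝ) : ℝ := ∫ s in r..(1 : ℝ), ω (s : ℂ)

/-- A radial weight: nonnegative, radial, integrable over the unit disc. -/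
def RadialWeight (ω : ℂ → ℝ) : Prop :=
  (∀ z, 0 ≤ ω z) ∧ (∀ z : ℂ, ω z = ω ((‖z‖ : ℝ) : ℂ)) ∧ IntegrableOn ω UD dA

/-- `ω̂ > 0` on `[0,1)`. -/
def WhatPos (ω : ℂ → ℝ) : Prop := ∀ r : ℝ, 0 ≤ r → r < 1 → 0 < what ω r

/-- The class `D̂`. -/
def Dhat (ω : ℂ → ℝ) : Prop :=
  ∃ C > (1 : ℝ), ∀ r : ℝ, 0 ≤ r → r < 1 → what ω r ≤ C * what ω ((1 + r) / 2)

/-- The class `Ď`. -/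
def Dcheck (ω : ℂ → ℝ) : Prop :=
  ∃ K > (1 : ℝ), ∃ C > (1 : ℝ), ∀ r : ℝ, 0 ≤ r → r < 1 →
    C * what ω (1 - (1 - r) / K) ≤ what ω r

/-- The class `D = D̂ ∩ Ď`. -/
def Dclass (ω : ℂ → ℝ) : Prop := Dhat ω ∧ Dcheck ω

/-- A `Ď`-exponent `α > 0` for `ω`: `ω̂(t) ≤ C ((1-t)/(1-r))^α ω̂(r)` for `0 ≤ r ≤ t < 1`. -/
def DcheckExp (ω : ℂ → ℝ) (α : ℝ) : Prop :=
  ∃ C > (0 : ℝ), ∀ r t : ℝ, 0 ≤ r → r ≤ t → t < 1 →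
    what ω t ≤ C * ((1 - t) / (1 - r)) ^ α * what ω r

/-- A `D̂`-exponent `β > 0` for `ω`: `ω̂(r) ≤ C ((1-r)/(1-t))^β ω̂(t)` for `0 ≤ r ≤ t < 1`. -/
def DhatExp (ω : ℂ → ℝ) (β : ℝ) : Prop :=
  ∃ C > (0 : ℝ), ∀ r t : ℝ, 0 ≤ r → r ≤ t → t < 1 →
    what ω r ≤ C * ((1 - r) / (1 - t)) ^ β * what ω t

/-- Weighted `L^p` "norm" over the unit disc. -/
def wnorm (p : ℝ) (ω : ℂ → ℝ) (f : ℂ → ℂ) : ℝ :=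
  (∫ z in UD, ‖f z‖ ^ p * ω z ∂dA) ^ (1 / p)

/-- Membership in the weighted Lebesgue space `L^p_ω`. -/
def MemLw (p : ℝ) (ω : ℂ → ℝ) (f : ℂ → ℂ) : Prop :=
  AEStronglyMeasurable f (dA.restrict UD) ∧
  IntegrableOn (fun z => ‖f z‖ ^ p * ω z) UD dA

/-- Membership in the weighted Bergman space `A^p_ω`. -/
def MemAp (p : ℝ) (ω : ℂ → ℝ) (f : ℂ → ℂ) : Prop :=
  DifferentiableOn ℂ f UD ∧ IntegrableOn (fun z => ‖f z‖ ^ p * ω z) UD dA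

/-- `H^∞`: bounded analytic functions on the unit disc. -/
def Hinfty (f : ℂ → ℂ) : Prop :=
  DifferentiableOn ℂ f UD ∧ ∃ M : ℝ, ∀ z ∈ UD, ‖f z‖ ≤ M

/-- Moments `ν_x = ∫_0^1 t^x ν(t) dt`. -/
def mom (ν : ℂ → ℝ) (x : ℝ) : ℝ := ∫ t in (0 : ℝ)..1, t ^ x * ν (t : ℂ)

/-- The Bergman reproducing kernel of `A²_ν`. -/
def Bker (ν : ℂ → ℝ) (z ζ : ℂ) : ℂ :=
  ∑' n : ℕ, (ζ * conj z) ^ n / (((2 * mom ν (2 * (n : ℝ) + 1) : ℝ)) : ℂ)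

/-- The Bergman projection `P_ν`. -/
def Pw (ν : ℂ → ℝ) (f : ℂ → ℂ) (z : ℂ) : ℂ :=
  ∫ ζ in UD, f ζ * conj (Bker ν z ζ) * ((ν ζ : ℝ) : ℂ) ∂dA

/-- The Hankel operator `H_f^ν(g) = f g − P_ν(f g)`. -/
def Hankel (ν : ℂ → ℝ) (f g : ℂ → ℂ) (z : ℂ) : ℂ :=
  f z * g z - Pw ν (fun ζ => f ζ * g ζ) z

/-- The standard weighted Bergman projection `P_η`. -/
def Pstd (η : ℝ) (f : ℂ → ℂ) (z : ℂ) : ℂ :=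
  (((η + 1 : ℝ)) : ℂ) *
    ∫ ζ in UD, f ζ * (((1 - ‖ζ‖ ^ 2) ^ η : ℝ) : ℂ) *
      (1 - z * conj ζ) ^ (((-(2 + η) : ℝ)) : ℂ) ∂dA

/-- The Bekollé–Bonami class `B_q` (for radial weights). -/
def Bq (q : ℝ) (ν : ℂ → ℝ) : Prop :=
  ∃ η > (-1 : ℝ), ∃ C > (0 : ℝ), ∀ f : ℂ → ℂ, MemLw q ν f →
    wnorm q ν (Pstd η f) ≤ C * wnorm q ν f

/-- Pseudo-hyperbolic distance. -/
def pd (z ζ : ℂ) : ℝ := ‖(z - ζ) / (1 - conj z * ζ)‖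

/-- Hyperbolic distance `β(z,ζ)`. -/
def hyp (z ζ : ℂ) : ℝ := (1 / 2) * Real.log ((1 + pd z ζ) / (1 - pd z ζ))

/-- The hyperbolic disc `Δ(z,r)`. -/
def hDisc (z : ℂ) (r : ℝ) : Set ℂ := {ζ ∈ UD | hyp z ζ < r}

/-- `ν(Δ(z,r))`. -/
def nuD (ν : ℂ → ℝ) (z : ℂ) (r : ℝ) : ℝ := ∫ ζ in hDisc z r, ν ζ ∂dA

/-- The function `γ(z)`. -/
def gam (ω ν : ℂ → ℝ) (p q : ℝ) (z : ℂ) : ℝ :=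
  (what ν ‖z‖) ^ (1 / q) * (1 - ‖z‖) ^ (1 / q) /
    ((what ω ‖z‖) ^ (1 / p) * (1 - ‖z‖) ^ (1 / p))

/-- The average `f̂_{r,ν}(z)`. -/
def havg (ν : ℂ → ℝ) (r : ℝ) (f : ℂ → ℂ) (z : ℂ) : ℂ :=
  (∫ ζ in hDisc z r, ν ζ • f ζ ∂dA) / ((nuD ν z r : ℝ) : ℂ)

/-- The mean oscillation `MO_{ν,q,r}(f)(z)`. -/
def MO (ν : ℂ → ℝ) (q r : ℝ) (f : ℂ → ℂ) (z : ℂ) : ℝ :=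
  ((∫ ζ in hDisc z r, ‖f ζ - havg ν r f z‖ ^ q * ν ζ ∂dA) / nuD ν z r) ^ (1 / q)

/-- Finiteness of the `BMO(Δ)_{ω,ν,p,q,r}` norm. -/
def BMOfin (ω ν : ℂ → ℝ) (p q r : ℝ) (f : ℂ → ℂ) : Prop :=
  ∃ M : ℝ, ∀ z ∈ UD, MO ν q r f z * gam ω ν p q z ≤ M

/-- Boundedness of the Hankel operator `H_f^ν : A^p_ω → L^q_ν` tested on `H^∞`. -/
def HankelBdd (p q : ℝ) (ω ν : ℂ → ℝ) (f : ℂ → ℂ) : Prop :=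
  ∃ C > (0 : ℝ), ∀ g : ℂ → ℂ, Hinfty g → wnorm q ν (Hankel ν f g) ≤ C * wnorm p ω g

/-- `ω̂` extended by the convention `ω̂(t) = ω̂(0)` for `t < 0`. -/
def whatE (ω : ℂ → ℝ) (t : ℝ) : ℝ := what ω (max t 0)

/-- The function `Γ_τ(z,ζ)`. -/
def Gam (ω ν : ℂ → ℝ) (p q τ : ℝ) (z ζ : ℂ) : ℝ :=
  ((‖1 - conj z * ζ‖ ^ 2 / max (1 - ‖z‖ ^ 2) (1 - ‖ζ‖ ^ 2)) ^ (1 / p - (τ + 1) / q) *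
      whatE ω (1 - 2 * ‖1 - conj z * ζ‖ ^ 2 / max (1 - ‖z‖ ^ 2) (1 - ‖ζ‖ ^ 2)) ^ (1 / p)) /
    (min (what ν ‖z‖ / (1 - ‖z‖) ^ τ) (what ν ‖ζ‖ / (1 - ‖ζ‖) ^ τ)) ^ (1 / q)

/-- The generalized Berezin transform `B_{ν,c,σ}(φ)(z)` of a real-valued `φ`. -/
def Ber (ν : ℂ → ℝ) (c σ : ℝ) (φ : ℂ → ℝ) (z : ℂ) : ℝ :=
  (1 - ‖z‖ ^ 2) ^ (c + 1) / what ν ‖z‖ *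
    ∫ ζ in UD, φ ζ * (1 - ‖ζ‖ ^ 2) ^ σ * ‖1 - z * conj ζ‖ ^ (-(2 + c + σ)) * ν ζ ∂dA

/-- The operator `T_{b,c}`. -/
def Tbc (b c : ℝ) (f : ℂ → ℂ) (z : ℂ) : ℂ :=
  ∫ ζ in UD, f ζ * (((1 - ‖ζ‖ ^ 2) ^ b : ℝ) : ℂ) * (1 - z * conj ζ) ^ (((-c : ℝ)) : ℂ) ∂dA

/-- The operator `S_{b,c}`. -/
def Sbc (b c : ℝ) (f : ℂ → ℂ) (z : ℂ) : ℂ :=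
  ∫ ζ in UD, f ζ * ((((1 - ‖ζ‖ ^ 2) ^ b * ‖1 - z * conj ζ‖ ^ (-c)) : ℝ) : ℂ) ∂dA

/-- The standard kernel `B^η_z(ζ) = (1 − conj(z) ζ)^{−(2+η)}`. -/
def Bstd (η : ℝ) (z ζ : ℂ) : ℂ := (1 - conj z * ζ) ^ (((-(2 + η) : ℝ)) : ℂ)

/-- The normalized kernel `b^η_{z,ω}`. -/
def bnrm (p : ℝ) (ω : ℂ → ℝ) (η : ℝ) (z ζ : ℂ) : ℂ :=
  Bstd η z ζ / ((wnorm p ω (Bstd η z) : ℝ) : ℂ)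

/-- The function `g^η_{z,ω} = P_ν(conj(f) b^η_{z,ω}) / b^η_{z,ω}`. -/
def gfn (ν : ℂ → ℝ) (p : ℝ) (ω : ℂ → ℝ) (η : ℝ) (f : ℂ → ℂ) (z ζ : ℂ) : ℂ :=
  Pw ν (fun u => conj (f u) * bnrm p ω η z u) ζ / bnrm p ω η z ζ

end

/-- Sub-mean value property of `‖f‖ ^ p` for analytic `f`. -/
theorem norm_rpow_le_circleAverage {f : ℂ → ℂ} {c : ℂ} {R p : ℝ} (hp : 0 < p) (hR : 0 < R)
    (hf : AnalyticOnNhd ℂ f (Metric.closedBall c R)) :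
    ‖f c‖ ^ p ≤ Real.circleAverage (fun z => ‖f z‖ ^ p) c R := by
  by_cases h0 : f c = 0
  · rw [h0, norm_zero, Real.zero_rpow hp.ne']
    exact Real.circleAverage_nonneg_of_nonneg fun z _ => by positivity
  have hRabs : |R| = R := abs_of_pos hR
  have hlog : CircleIntegrable (fun z => Real.log ‖f z‖) c R :=
    MeromorphicOn.circleIntegrable_log_norm fun z hz =>
      (hf z (Metric.sphere_subset_closedBall (by rwa [hRabs] at hz))).meromorphicAt
  have hjensen : Real.log ‖f c‖ ≤ Real.circleAverage (fun z => Real.log ‖f z‖) c R := by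
    rw [AnalyticOnNhd.circleAverage_log_norm hR.ne' (by rwa [hRabs]) h0]
    refine le_add_of_nonneg_left (finsum_nonneg fun u => ?_)
    by_cases hu : u ∈ Metric.closedBall c |R|
    · refine mul_nonneg ?_ ?_
      · exact_mod_cast MeromorphicOn.AnalyticOnNhd.divisor_nonneg (by rwa [hRabs]) u
      · rcases eq_or_ne c u with rfl | hne
        · simp
        · have hpos : 0 < ‖c - u‖ := norm_pos_iff.2 (sub_ne_zero.2 hne)
          refine Real.log_nonneg ?_
          rw [← div_eq_mul_inv, one_le_div hpos, norm_sub_rev]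
          simpa [hRabs, dist_eq_norm] using hu
    · simp [hu]
  have hne : ∀ᶠ z in Filter.codiscreteWithin (Metric.sphere c |R|), f z ≠ 0 := by
    rw [hRabs]
    refine Filter.codiscreteWithin_mono Metric.sphere_subset_closedBall
      ((hf.eqOn_zero_or_eventually_ne_zero_of_preconnected
        (convex_closedBall c R).isPreconnected).resolve_left fun h => h0 (h ?_))
    exact Metric.mem_closedBall_self hR.le
  have hcongr : (fun z => Real.exp (p * Real.log ‖f z‖))
      =ᶠ[Filter.codiscreteWithin (Metric.sphere c |R|)] fun z => ‖f z‖ ^ p := by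
    filter_upwards [hne] with z hz
    rw [Real.rpow_def_of_pos (norm_pos_iff.2 hz), mul_comm]
  have hint : CircleIntegrable (fun z => ‖f z‖ ^ p) c R := by
    refine ContinuousOn.circleIntegrable hR.le ?_
    exact (hf.continuousOn.mono Metric.sphere_subset_closedBall).norm.rpow_const
      fun _ _ => Or.inr hp.le
  rw [← Real.circleAverage_congr_codiscreteWithin hcongr hR.ne']
  set A := Real.log ‖f c‖ with hA
  have hfc : ‖f c‖ ^ p = Real.exp (p * A) := by
    rw [Real.rpow_def_of_pos (norm_pos_iff.2 h0), mul_comm]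
  have htangent : CircleIntegrable
      (fun z => Real.exp (p * A) * p * Real.log ‖f z‖ + Real.exp (p * A) * (1 - p * A)) c R :=
    (hlog.const_mul (Real.exp (p * A) * p)).add
      (circleIntegrable_const (Real.exp (p * A) * (1 - p * A)) c R)
  have hmono := Real.circleAverage_mono htangent
    (CircleIntegrable.congr_codiscreteWithin hcongr.symm hint) fun z _ => by
      have h1 := Real.add_one_le_exp (p * Real.log ‖f z‖ - p * A)
      have h2 : Real.exp (p * Real.log ‖f z‖)
          = Real.exp (p * A) * Real.exp (p * Real.log ‖f z‖ - p * A) := by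
        rw [← Real.exp_add]; ring_nf
      have h3 := mul_le_mul_of_nonneg_left h1 (Real.exp_pos (p * A)).le
      rw [h2]
      linarith
  refine le_trans ?_ hmono
  have hlin : CircleIntegrable (fun z => Real.exp (p * A) * p * Real.log ‖f z‖) c R :=
    hlog.const_mul (Real.exp (p * A) * p)
  rw [Real.circleAverage_fun_add hlin (circleIntegrable_const _ c R), Real.circleAverage_const]
  have : Real.circleAverage (fun z => Real.exp (p * A) * p * Real.log ‖f z‖) c R
      = Real.exp (p * A) * p * Real.circleAverage (fun z => Real.log ‖f z‖) c R := by
    simpa [smul_eq_mul] using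
      Real.circleAverage_fun_smul (a := Real.exp (p * A) * p) (f := fun z => Real.log ‖f z‖)
        (c := c) (R := R)
  rw [this, hfc]
  have := mul_le_mul_of_nonneg_left hjensen (mul_pos (Real.exp_pos (p * A)) hp).le
  linarith

/-- Circle means of a continuous function all of whose rotations satisfy a sub-mean value property
obey a maximum principle. -/
theorem circleAverage_le_of_subMean {u : ℂ → ℝ} (hu : Continuous u) {r s : ℝ} (hr : 0 ≤ r)
    (hrs : r ≤ s)
    (h : ∀ (θ : ℝ) (z : ℂ), ‖z‖ < s → u (z * Complex.exp (θ * Complex.I)) ≤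
      Real.circleAverage (fun w => u (w * Complex.exp (θ * Complex.I))) z (s - ‖z‖)) :
    Real.circleAverage u 0 r ≤ Real.circleAverage u 0 s := by
  set G : ℂ → ℝ := fun z => ∫ θ in (0 : ℝ)..2 * Real.pi, u (z * Complex.exp (θ * Complex.I))
    with hG
  have hGcont : Continuous G := by
    apply intervalIntegral.continuous_parametric_intervalIntegral_of_continuous'
    fun_prop
  have hGavg : ∀ (t φ : ℝ), Real.circleAverage u 0 t
      = (2 * Real.pi)⁻¹ * G (t * Complex.exp (φ * Complex.I)) := by
    intro t φ
    rw [Real.circleAverage_eq_integral_add φ, smul_eq_mul]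
    congr 1
    refine intervalIntegral.integral_congr fun θ _ => ?_
    simp only [circleMap, zero_add]
    congr 1
    rw [mul_assoc, ← Complex.exp_add]
    push_cast
    ring_nf
  have hGavg' : ∀ w : ℂ, Real.circleAverage u 0 ‖w‖ = (2 * Real.pi)⁻¹ * G w := fun w => by
    rw [hGavg ‖w‖ w.arg, Complex.norm_mul_exp_arg_mul_I]
  have hsub : ∀ z : ℂ, ‖z‖ < s → 2 * Real.pi * G z ≤
      ∫ φ in (0 : ℝ)..2 * Real.pi, G (circleMap z (s - ‖z‖) φ) := by
    intro z hz
    have hswap : ∫ φ in (0 : ℝ)..2 * Real.pi, G (circleMap z (s - ‖z‖) φ)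
        = ∫ θ in (0 : ℝ)..2 * Real.pi, ∫ φ in (0 : ℝ)..2 * Real.pi,
          u (circleMap z (s - ‖z‖) φ * Complex.exp (θ * Complex.I)) := by
      simp only [hG]
      refine MeasureTheory.intervalIntegral_intervalIntegral_swap ?_
      have hc : Continuous (Function.uncurry fun φ θ : ℝ =>
          u (circleMap z (s - ‖z‖) φ * Complex.exp (θ * Complex.I))) := by
        simp only [Function.uncurry_def, circleMap]
        fun_prop
      exact (hc.continuousOn.integrableOn_compact (isCompact_uIcc.prod isCompact_uIcc)).mono_set
        (Set.prod_mono uIoc_subset_uIcc uIoc_subset_uIcc)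
    rw [hswap, hG, ← intervalIntegral.integral_const_mul]
    refine intervalIntegral.integral_mono_on Real.two_pi_pos.le ?_ ?_ fun θ _ => ?_
    · exact Continuous.intervalIntegrable (by fun_prop) _ _
    · refine Continuous.intervalIntegrable ?_ _ _
      apply intervalIntegral.continuous_parametric_intervalIntegral_of_continuous'
      fun_prop
    · have := h θ z hz
      rw [Real.circleAverage, smul_eq_mul, inv_mul_eq_div, le_div_iff₀ Real.two_pi_pos] at this
      linarith
  obtain ⟨z₀, hz₀, hmax⟩ := (isCompact_closedBall (0 : ℂ) s).exists_isMaxOn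
    ⟨0, Metric.mem_closedBall_self (hr.trans hrs)⟩ hGcont.continuousOn
  have hmax' : ∀ z : ℂ, ‖z‖ ≤ s → G z ≤ G z₀ := fun z hz => hmax (by simpa using hz)
  have hz₀' : ‖z₀‖ ≤ s := by simpa using hz₀
  have key : ∃ w : ℂ, ‖w‖ = s ∧ G z₀ ≤ G w := by
    rcases hz₀'.eq_or_lt with heq | hlt
    · exact ⟨z₀, heq, le_rfl⟩
    by_contra! hcon
    have hρ : 0 < s - ‖z₀‖ := sub_pos.2 hlt
    have hnorm : ∀ φ, ‖circleMap z₀ (s - ‖z₀‖) φ‖ ≤ s := fun φ => by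
      refine (norm_add_le _ _).trans ?_
      have : ‖((s - ‖z₀‖ : ℝ) : ℂ) * Complex.exp (φ * Complex.I)‖ = s - ‖z₀‖ := by
        rw [norm_mul, Complex.norm_exp_ofReal_mul_I, mul_one, Complex.norm_real,
          Real.norm_of_nonneg hρ.le]
      rw [this]
      linarith
    obtain ⟨w, hw, hws⟩ : ∃ w ∈ Metric.sphere z₀ (s - ‖z₀‖), ‖w‖ = s := by
      refine ⟨s * Complex.exp (z₀.arg * Complex.I), ?_, ?_⟩
      · rw [mem_sphere_iff_norm]
        nth_rewrite 2 [← Complex.norm_mul_exp_arg_mul_I z₀]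
        rw [← sub_mul, norm_mul, Complex.norm_exp_ofReal_mul_I, mul_one, ← Complex.ofReal_sub,
          Complex.norm_real, Real.norm_of_nonneg hρ.le]
      · simp [abs_of_nonneg (hr.trans hrs)]
    rw [← abs_of_pos hρ, ← image_circleMap_Ioc] at hw
    obtain ⟨φ₀, hφ₀, rfl⟩ := hw
    have hint := intervalIntegral.integral_lt_integral_of_continuousOn_of_le_of_exists_lt
      (f := fun φ => G (circleMap z₀ (s - ‖z₀‖) φ)) (g := fun _ => G z₀) Real.two_pi_pos
      (hGcont.comp (continuous_circleMap _ _)).continuousOn continuousOn_const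
      (fun φ _ => hmax' _ (hnorm φ)) ⟨φ₀, Ioc_subset_Icc_self hφ₀, hcon _ hws⟩
    have := hsub z₀ hlt
    rw [intervalIntegral.integral_const, smul_eq_mul, sub_zero] at hint
    linarith
  obtain ⟨w, hws, hw⟩ := key
  rw [← hws, hGavg' w, hGavg r 0]
  gcongr
  exact (hmax' _ (by simpa [abs_of_nonneg hr] using hrs)).trans hw

/-- Hardy's convexity theorem, monotonicity part: the integral means `M_p(r, f)` increase. -/
theorem circleAverage_norm_rpow_mono {f : ℂ → ℂ} (hf : DifferentiableOn ℂ f (Metric.ball 0 1))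
    {p r s : ℝ} (hp : 0 < p) (hr : 0 ≤ r) (hrs : r ≤ s) (hs : s < 1) :
    Real.circleAverage (fun z => ‖f z‖ ^ p) 0 r ≤
      Real.circleAverage (fun z => ‖f z‖ ^ p) 0 s := by
  rcases (hr.trans hrs).eq_or_lt with hs0 | hs0
  · rw [le_antisymm hrs (hs0 ▸ hr)]
  set P : ℂ → ℂ := fun z => (((max 1 (‖z‖ / s))⁻¹ : ℝ) : ℂ) * z with hP
  have hPcont : Continuous P := by
    refine (Complex.continuous_ofReal.comp (Continuous.inv₀ (by fun_prop) fun z => ?_)).mul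
      continuous_id
    exact (lt_max_of_lt_left one_pos).ne'
  have hPid : ∀ z, ‖z‖ ≤ s → P z = z := fun z hz => by
    simp [hP, max_eq_left ((div_le_one hs0).2 hz)]
  have hPball : ∀ z, P z ∈ Metric.ball (0 : ℂ) 1 := fun z => by
    rw [mem_ball_zero_iff, hP, norm_mul, Complex.norm_real, norm_inv,
      Real.norm_of_nonneg (zero_le_one.trans (le_max_left _ _)), inv_mul_lt_iff₀ (by positivity)]
    rcases le_or_gt ‖z‖ s with h | h
    · exact (h.trans_lt hs).trans_le (by simp)
    · calc ‖z‖ = ‖z‖ / s * s := by field_simp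
        _ < ‖z‖ / s * 1 := by gcongr; exact div_pos (hs0.trans h) hs0
        _ ≤ _ := by gcongr; exact le_max_right _ _
  set u : ℂ → ℝ := fun z => ‖f (P z)‖ ^ p with hu
  have hucont : Continuous u := by
    refine Continuous.rpow_const (continuous_norm.comp ?_) fun _ => Or.inr hp.le
    exact hf.continuousOn.comp_continuous hPcont hPball
  have huf : ∀ t, 0 ≤ t → t ≤ s →
      Real.circleAverage (fun z => ‖f z‖ ^ p) 0 t = Real.circleAverage u 0 t := by
    intro t ht hts
    refine Real.circleAverage_congr_sphere fun z hz => ?_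
    rw [mem_sphere_zero_iff_norm, abs_of_nonneg ht] at hz
    simp only [hu, hPid z (hz.trans_le hts)]
  rw [huf r hr hrs, huf s hs0.le le_rfl]
  refine circleAverage_le_of_subMean hucont hr hrs fun θ z hz => ?_
  have hmem : ∀ w ∈ Metric.closedBall z (s - ‖z‖), ‖w * Complex.exp (θ * Complex.I)‖ ≤ s := by
    intro w hw
    rw [norm_mul, Complex.norm_exp_ofReal_mul_I, mul_one]
    rw [mem_closedBall_iff_norm] at hw
    linarith [norm_le_norm_add_norm_sub z w, norm_sub_rev z w]
  have han : AnalyticOnNhd ℂ (fun w => f (w * Complex.exp (θ * Complex.I)))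
      (Metric.closedBall z (s - ‖z‖)) := by
    intro w hw
    have h1 : AnalyticAt ℂ f (w * Complex.exp (θ * Complex.I)) :=
      hf.analyticAt (Metric.isOpen_ball.mem_nhds (by simpa using (hmem w hw).trans_lt hs))
    exact h1.fun_comp (f := fun w => w * Complex.exp (θ * Complex.I)) (by fun_prop)
  have hsub := norm_rpow_le_circleAverage hp (sub_pos.2 hz) han
  have hz' := hmem z (Metric.mem_closedBall_self (sub_pos.2 hz).le)
  simp only [hu]
  rw [hPid _ hz']
  refine hsub.trans_eq (Real.circleAverage_congr_sphere fun w hw => ?_)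
  rw [abs_of_pos (sub_pos.2 hz)] at hw
  simp only [hPid _ (hmem w (Metric.sphere_subset_closedBall hw))]

theorem rpow_le_of_mul_bounds {x y K e : ℝ} (hy : 0 < y) (hyx : y ≤ x) (hxK : x ≤ K * y) :
    x ^ e ≤ max 1 (K ^ e) * y ^ e := by
  have h1 : 1 ≤ x / y := (one_le_div hy).2 hyx
  have h2 : x / y ≤ K := (div_le_iff₀ hy).2 hxK
  have h3 : (x / y) ^ e ≤ max 1 (K ^ e) := by
    rcases le_total 0 e with he | he
    · exact (Real.rpow_le_rpow (by positivity) h2 he).trans (le_max_right _ _)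
    · exact (Real.rpow_le_one_of_one_le_of_nonpos h1 he).trans (le_max_left _ _)
  calc x ^ e = (x / y) ^ e * y ^ e := by
        rw [← Real.mul_rpow (by positivity) hy.le, div_mul_cancel₀ _ hy.ne']
    _ ≤ _ := by gcongr

/-- Integrating a tail-type function against a monotone function is controlled by integrating the
density, when the tail is dominated by nearby mass. -/
theorem lintegral_tail_le_lintegral_density {N W H : ℝ → ℝ≥0∞} (hN : MonotoneOn N (Ioo 0 1))
    (hW : AEMeasurable W (volume.restrict (Ioo 0 1))) {K k : ℝ} (hK : 1 < K) {c : ℝ≥0∞}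
    (hc : c ≠ ∞) (hH : ∀ r ∈ Ioo (0 : ℝ) 1, H r ≤ c * ∫⁻ s in Ioc r (1 - (1 - r) / K), W s) :
    ∫⁻ r in Ioo 0 1, N r * (ENNReal.ofReal ((1 - r) ^ (k - 1)) * H r) ≤
      c * ENNReal.ofReal (max 1 (K ^ (k - 1)) * (K - 1)) *
        ∫⁻ s in Ioo 0 1, N s * (ENNReal.ofReal ((1 - s) ^ k) * W s) := by
  have hK0 : 0 < K := one_pos.trans hK
  have hNm := aemeasurable_restrict_of_monotoneOn (μ := volume) measurableSet_Ioo hN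
  set E : Set (ℝ × ℝ) := {q | q.1 < q.2 ∧ q.2 ≤ 1 - (1 - q.1) / K} with hE
  have hEm : MeasurableSet E := by
    exact (measurableSet_lt measurable_fst measurable_snd).inter
      (measurableSet_le (f := fun q : ℝ × ℝ => q.2) (g := fun q => 1 - (1 - q.1) / K)
        (by fun_prop) (by fun_prop))
  set φ : ℝ × ℝ → ℝ≥0∞ := E.indicator 1 with hφ
  have hφm : Measurable φ := measurable_one.indicator hEm
  set v : ℝ → ℝ≥0∞ := fun r => ENNReal.ofReal ((1 - r) ^ (k - 1)) with hv
  have hvm : Measurable v := by fun_prop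
  calc ∫⁻ r in Ioo 0 1, N r * (v r * H r)
      ≤ ∫⁻ r in Ioo 0 1, c * ∫⁻ s in Ioo 0 1, N r * v r * (φ (r, s) * W s) := by
        refine setLIntegral_mono' measurableSet_Ioo fun r hr => ?_
        have hsub : Ioc r (1 - (1 - r) / K) ⊆ Ioo 0 1 := fun s hs =>
          ⟨hr.1.trans hs.1, hs.2.trans_lt (by have := div_pos (sub_pos.2 hr.2) hK0; linarith)⟩
        have h1 : ∫⁻ s in Ioc r (1 - (1 - r) / K), W s ≤ ∫⁻ s in Ioo 0 1, φ (r, s) * W s := by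
          refine le_trans (setLIntegral_mono' measurableSet_Ioc fun s hs => ?_)
            (lintegral_mono_set hsub)
          rw [hφ, indicator_of_mem (show (r, s) ∈ E from hs), Pi.one_apply, one_mul]
        have hm : AEMeasurable (fun s => φ (r, s) * W s) (volume.restrict (Ioo 0 1)) :=
          (hφm.comp measurable_prodMk_left).aemeasurable.mul hW
        rw [lintegral_const_mul'' _ hm]
        calc N r * (v r * H r) ≤ N r * (v r * (c * ∫⁻ s in Ioo 0 1, φ (r, s) * W s)) := by
              gcongr
              exact (hH r hr).trans (by gcongr)
          _ = _ := by ring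
    _ = c * ∫⁻ s in Ioo 0 1, ∫⁻ r in Ioo 0 1, N r * v r * (φ (r, s) * W s) := by
        rw [lintegral_const_mul' _ _ hc, lintegral_lintegral_swap]
        exact ((hNm.mul hvm.aemeasurable).comp_fst).mul (hφm.aemeasurable.mul hW.comp_snd)
    _ ≤ c * ∫⁻ s in Ioo 0 1, ENNReal.ofReal (max 1 (K ^ (k - 1)) * (K - 1)) *
          (N s * (ENNReal.ofReal ((1 - s) ^ k) * W s)) := by
        refine mul_le_mul_right (setLIntegral_mono' measurableSet_Ioo fun s hs => ?_) c
        have hs1 : 0 < 1 - s := sub_pos.2 hs.2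
        have hM : 0 ≤ max 1 (K ^ (k - 1)) := zero_le_one.trans (le_max_left _ _)
        calc ∫⁻ r in Ioo 0 1, N r * v r * (φ (r, s) * W s)
            ≤ ∫⁻ r in Ioo 0 1, (Ico (1 - K * (1 - s)) s).indicator (fun _ =>
                N s * ENNReal.ofReal (max 1 (K ^ (k - 1)) * (1 - s) ^ (k - 1)) * W s) r := by
              refine setLIntegral_mono' measurableSet_Ioo fun r hr => ?_
              by_cases hrs : (r, s) ∈ E
              · have h1 : 1 - r ≤ K * (1 - s) := by
                  have h2 : (1 - r) / K ≤ 1 - s := by linarith [hrs.2]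
                  rwa [div_le_iff₀' hK0] at h2
                have h2 : r < s := hrs.1
                rw [indicator_of_mem (show r ∈ Ico (1 - K * (1 - s)) s from ⟨by linarith, h2⟩),
                  hφ, indicator_of_mem hrs, Pi.one_apply, one_mul]
                gcongr
                · exact hN hr hs h2.le
                · exact ENNReal.ofReal_le_ofReal (rpow_le_of_mul_bounds hs1 (by linarith) h1)
              · rw [hφ, indicator_of_notMem hrs]
                simp
          _ ≤ N s * ENNReal.ofReal (max 1 (K ^ (k - 1)) * (1 - s) ^ (k - 1)) * W s *
                volume (Ico (1 - K * (1 - s)) s) := by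
              rw [lintegral_indicator_const measurableSet_Ico]
              gcongr
              exact Measure.restrict_le_self
          _ = N s * W s * (ENNReal.ofReal (max 1 (K ^ (k - 1)) * (1 - s) ^ (k - 1)) *
                ENNReal.ofReal ((K - 1) * (1 - s))) := by
              rw [Real.volume_Ico, show s - (1 - K * (1 - s)) = (K - 1) * (1 - s) by ring]
              ring
          _ = N s * W s * (ENNReal.ofReal (max 1 (K ^ (k - 1)) * (K - 1)) *
                ENNReal.ofReal ((1 - s) ^ k)) := by
              rw [← ENNReal.ofReal_mul (by positivity), ← ENNReal.ofReal_mul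
                (mul_nonneg hM (by linarith))]
              congr 2
              rw [Real.rpow_sub_one hs1.ne']
              field_simp
          _ = _ := by ring
    _ = _ := by rw [lintegral_const_mul' _ _ ENNReal.ofReal_ne_top, mul_assoc]

/-- Integrating a density against a monotone function is controlled by integrating a tail-type
function which dominates the mass of the density on a Carleson-type neighbourhood. -/
theorem lintegral_density_le_lintegral_tail {N W H : ℝ → ℝ≥0∞} (hN : MonotoneOn N (Ioo 0 1))
    (hW : AEMeasurable W (volume.restrict (Ioo 0 1))) {k : ℝ} {c : ℝ≥0∞} (hc : c ≠ ∞)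
    (hH : ∀ t ∈ Ioo (0 : ℝ) 1, ∫⁻ s in Ioc (max 0 (2 * t - 1)) 1, W s ≤ c * H t) :
    ∫⁻ s in Ioo 0 1, N s * (ENNReal.ofReal ((1 - s) ^ k) * W s) ≤
      c * ENNReal.ofReal (2 * max 1 (2 ^ (k - 1))) *
        ∫⁻ t in Ioo 0 1, N t * (ENNReal.ofReal ((1 - t) ^ (k - 1)) * H t) := by
  have hNm := aemeasurable_restrict_of_monotoneOn (μ := volume) measurableSet_Ioo hN
  set E : Set (ℝ × ℝ) := {q | q.1 < q.2 ∧ q.2 < (1 + q.1) / 2} with hE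
  have hEm : MeasurableSet E := by
    exact (measurableSet_lt measurable_fst measurable_snd).inter
      (measurableSet_lt (f := fun q : ℝ × ℝ => q.2) (g := fun q => (1 + q.1) / 2)
        (by fun_prop) (by fun_prop))
  set φ : ℝ × ℝ → ℝ≥0∞ := E.indicator 1 with hφ
  have hφm : Measurable φ := measurable_one.indicator hEm
  set v : ℝ → ℝ≥0∞ := fun r => ENNReal.ofReal ((1 - r) ^ (k - 1)) with hv
  have hvm : Measurable v := by fun_prop
  set A : ℝ≥0∞ := ENNReal.ofReal (2 * max 1 (2 ^ (k - 1))) with hA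
  have hAtop : A ≠ ∞ := ENNReal.ofReal_ne_top
  calc ∫⁻ s in Ioo 0 1, N s * (ENNReal.ofReal ((1 - s) ^ k) * W s)
      ≤ ∫⁻ s in Ioo 0 1, A * ∫⁻ t in Ioo 0 1, φ (s, t) * (N t * v t) * W s := by
        refine setLIntegral_mono' measurableSet_Ioo fun s hs => ?_
        have hs1 : 0 < 1 - s := sub_pos.2 hs.2
        have hsub : Ioo s ((1 + s) / 2) ⊆ Ioo 0 1 := fun t ht =>
          ⟨hs.1.trans ht.1, by linarith [ht.2, hs.2]⟩
        have hm : AEMeasurable (fun t => φ (s, t) * (N t * v t)) (volume.restrict (Ioo 0 1)) :=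
          (hφm.comp measurable_prodMk_left).aemeasurable.mul (hNm.mul hvm.aemeasurable)
        have h1 : N s * ENNReal.ofReal ((1 - s) ^ k) ≤
            A * ∫⁻ t in Ioo 0 1, φ (s, t) * (N t * v t) := by
          calc N s * ENNReal.ofReal ((1 - s) ^ k)
              = ∫⁻ _ in Ioo s ((1 + s) / 2), N s * ENNReal.ofReal (2 * (1 - s) ^ (k - 1)) := by
                rw [setLIntegral_const, Real.volume_Ioo, mul_assoc,
                  ← ENNReal.ofReal_mul (by positivity)]
                congr 2
                rw [Real.rpow_sub_one hs1.ne']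
                field_simp
                ring
            _ ≤ ∫⁻ t in Ioo s ((1 + s) / 2), A * (φ (s, t) * (N t * v t)) := by
                refine setLIntegral_mono' measurableSet_Ioo fun t ht => ?_
                rw [hφ, indicator_of_mem (show (s, t) ∈ E from ht), Pi.one_apply, one_mul]
                have h2 : ENNReal.ofReal (2 * (1 - s) ^ (k - 1)) ≤ A * v t := by
                  rw [hA, hv, ← ENNReal.ofReal_mul (by positivity)]
                  refine ENNReal.ofReal_le_ofReal ?_
                  rw [mul_assoc]
                  gcongr
                  exact rpow_le_of_mul_bounds (by linarith [(hsub ht).2]) (by linarith [ht.1])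
                    (by linarith [ht.2])
                calc _ ≤ N t * (A * v t) := by gcongr; exact hN hs (hsub ht) ht.1.le
                  _ = _ := by ring
            _ ≤ ∫⁻ t in Ioo 0 1, A * (φ (s, t) * (N t * v t)) := lintegral_mono_set hsub
            _ = _ := lintegral_const_mul' _ _ hAtop
        rw [lintegral_mul_const'' _ hm]
        calc _ = N s * ENNReal.ofReal ((1 - s) ^ k) * W s := by ring
          _ ≤ A * (∫⁻ t in Ioo 0 1, φ (s, t) * (N t * v t)) * W s := by gcongr
          _ = _ := by ring
    _ = A * ∫⁻ t in Ioo 0 1, ∫⁻ s in Ioo 0 1, φ (s, t) * (N t * v t) * W s := by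
        rw [lintegral_const_mul' _ _ hAtop, lintegral_lintegral_swap]
        exact (hφm.aemeasurable.mul (hNm.mul hvm.aemeasurable).comp_snd).mul hW.comp_fst
    _ ≤ A * ∫⁻ t in Ioo 0 1, c * (N t * (v t * H t)) := by
        refine mul_le_mul_right (setLIntegral_mono' measurableSet_Ioo fun t ht => ?_) A
        have hm : AEMeasurable (fun s => φ (s, t) * W s) (volume.restrict (Ioo 0 1)) :=
          (hφm.comp measurable_prodMk_right).aemeasurable.mul hW
        have h1 : ∫⁻ s in Ioo 0 1, φ (s, t) * W s ≤ c * H t := by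
          refine le_trans ?_ (hH t ht)
          rw [← lintegral_indicator measurableSet_Ioc, ← lintegral_indicator measurableSet_Ioo]
          refine lintegral_mono fun s => ?_
          by_cases hs : s ∈ Ioo (0 : ℝ) 1
          · rw [indicator_of_mem hs]
            by_cases hst : (s, t) ∈ E
            · have h2 : t < (1 + s) / 2 := hst.2
              rw [hφ, indicator_of_mem hst, indicator_of_mem
                (show s ∈ Ioc (max 0 (2 * t - 1)) 1 from ⟨max_lt hs.1 (by linarith), hs.2.le⟩)]
              simp
            · rw [hφ, indicator_of_notMem hst]
              simp
          · rw [indicator_of_notMem hs]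
            exact zero_le
        calc ∫⁻ s in Ioo 0 1, φ (s, t) * (N t * v t) * W s
            = ∫⁻ s in Ioo 0 1, N t * v t * (φ (s, t) * W s) := by
              refine lintegral_congr fun s => ?_
              ring
          _ = N t * v t * ∫⁻ s in Ioo 0 1, φ (s, t) * W s := lintegral_const_mul'' _ hm
          _ ≤ N t * v t * (c * H t) := by gcongr
          _ = _ := by ring
    _ = _ := by rw [lintegral_const_mul' _ _ hc]; ring

/-- Polar coordinates for a radial weight times `‖f‖ ^ p` over the unit disc. -/
theorem lintegral_UD_norm_rpow_mul_radial {f : ℂ → ℂ} (hf : DifferentiableOn ℂ f UD) {p : ℝ}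
    (hp : 0 < p) {g : ℝ → ℝ} (hg : AEMeasurable g (volume.restrict (Ioo 0 1))) :
    ∫⁻ z in UD, ENNReal.ofReal (‖f z‖ ^ p * g ‖z‖) ∂dA =
      (ENNReal.ofReal Real.pi)⁻¹ * ENNReal.ofReal (2 * Real.pi) * ∫⁻ r in Ioo (0 : ℝ) 1,
        (ENNReal.ofReal r * ENNReal.ofReal (Real.circleAverage (fun z => ‖f z‖ ^ p) 0 r)) *
          ENNReal.ofReal (g r) := by
  have hmapsTo : ∀ r ∈ Ioo (0 : ℝ) 1, ∀ θ, circleMap 0 r θ ∈ UD := fun r hr θ => by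
    simpa [UD, abs_of_pos hr.1] using hr.2
  have hmean : ∀ r ∈ Ioo (0 : ℝ) 1,
      ∫⁻ θ in Ioo (-Real.pi) Real.pi, ENNReal.ofReal (‖f (circleMap 0 r θ)‖ ^ p) =
        ENNReal.ofReal (2 * Real.pi) *
          ENNReal.ofReal (Real.circleAverage (fun z => ‖f z‖ ^ p) 0 r) := by
    intro r hr
    have hcont : Continuous fun θ => ‖f (circleMap 0 r θ)‖ ^ p :=
      (hf.continuousOn.comp_continuous (continuous_circleMap 0 r) (hmapsTo r hr)).norm.rpow_const
        fun _ => Or.inr hp.le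
    rw [← ofReal_integral_eq_lintegral_ofReal
      ((hcont.integrableOn_Icc (a := -Real.pi) (b := Real.pi)).mono_set Ioo_subset_Icc_self)
      (ae_of_all _ fun θ => by positivity), ← ENNReal.ofReal_mul Real.two_pi_pos.le,
      Real.circleAverage_eq_integral_add (-Real.pi), smul_eq_mul,
      mul_inv_cancel_left₀ Real.two_pi_pos.ne',
      intervalIntegral.integral_comp_add_right (fun θ => ‖f (circleMap 0 r θ)‖ ^ p),
      intervalIntegral.integral_of_le (by linarith [Real.pi_pos]), integral_Ioc_eq_integral_Ioo]
    ring_nf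
  rw [dA, Measure.restrict_smul, lintegral_smul_measure, smul_eq_mul, mul_assoc]
  congr 1
  have hUD : MeasurableSet UD := Metric.isOpen_ball.measurableSet
  rw [← lintegral_indicator hUD,
    ← Complex.lintegral_comp_polarCoord_symm, polarCoord_target,
    ← lintegral_const_mul' _ _ ENNReal.ofReal_ne_top]
  set F : ℝ × ℝ → ℝ≥0∞ := fun q =>
    ENNReal.ofReal q.1 * (ENNReal.ofReal (‖f (circleMap 0 q.1 q.2)‖ ^ p) * ENNReal.ofReal (g q.1))
    with hF
  have hfm : AEMeasurable (fun q : ℝ × ℝ => ENNReal.ofReal (‖f (circleMap 0 q.1 q.2)‖ ^ p))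
      (volume.restrict (Ioo 0 1 ×ˢ Ioo (-Real.pi) Real.pi)) := by
    refine (ContinuousOn.aemeasurable ?_ (measurableSet_Ioo.prod measurableSet_Ioo)).ennreal_ofReal
    refine ContinuousOn.rpow_const (ContinuousOn.norm ?_) fun _ _ => Or.inr hp.le
    refine hf.continuousOn.comp (Continuous.continuousOn ?_) fun q hq => hmapsTo _ hq.1 _
    simp only [circleMap]
    fun_prop
  have hFm : AEMeasurable F
      ((volume.restrict (Ioo (0 : ℝ) 1)).prod (volume.restrict (Ioo (-Real.pi) Real.pi))) := by
    rw [Measure.prod_restrict, ← Measure.volume_eq_prod]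
    refine AEMeasurable.mul (by fun_prop) (hfm.mul ?_)
    rw [Measure.volume_eq_prod, ← Measure.prod_restrict]
    exact hg.ennreal_ofReal.comp_fst
  calc ∫⁻ q in Ioi (0 : ℝ) ×ˢ Ioo (-Real.pi) Real.pi, ENNReal.ofReal q.1 •
        UD.indicator (fun z => ENNReal.ofReal (‖f z‖ ^ p * g ‖z‖)) (Complex.polarCoord.symm q)
      = ∫⁻ q in Ioo (0 : ℝ) 1 ×ˢ Ioo (-Real.pi) Real.pi, F q := by
        rw [← lintegral_indicator (measurableSet_Ioi.prod measurableSet_Ioo),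
          ← lintegral_indicator (measurableSet_Ioo.prod measurableSet_Ioo)]
        refine lintegral_congr fun q => ?_
        have hq : Complex.polarCoord.symm q = circleMap 0 q.1 q.2 := by
          rw [Complex.polarCoord_symm_apply, circleMap_zero, Complex.exp_mul_I]
          push_cast
          rfl
        by_cases h : q ∈ Ioi (0 : ℝ) ×ˢ Ioo (-Real.pi) Real.pi
        · have h0 : 0 < q.1 := h.1
          rw [indicator_of_mem h, hq]
          by_cases h1 : q.1 < 1
          · have hn : ‖circleMap 0 q.1 q.2‖ = q.1 := by simp [abs_of_pos h0]
            rw [indicator_of_mem (hmapsTo q.1 ⟨h0, h1⟩ q.2), indicator_of_mem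
              (show q ∈ Ioo (0 : ℝ) 1 ×ˢ Ioo (-Real.pi) Real.pi from ⟨⟨h0, h1⟩, h.2⟩), hn,
              ENNReal.ofReal_mul (by positivity), smul_eq_mul]
          · rw [indicator_of_notMem fun hm => h1 (by simpa [UD, abs_of_pos h0] using hm),
              indicator_of_notMem fun hm => h1 hm.1.2, smul_zero]
        · rw [indicator_of_notMem h, indicator_of_notMem fun hm => h ⟨hm.1.1, hm.2⟩]
    _ = ∫⁻ r in Ioo (0 : ℝ) 1, ∫⁻ θ in Ioo (-Real.pi) Real.pi, F (r, θ) := by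
        rw [Measure.volume_eq_prod, ← Measure.prod_restrict, lintegral_prod _ hFm]
    _ = _ := by
        refine setLIntegral_congr_fun measurableSet_Ioo fun r hr => ?_
        simp only [hF]
        rw [lintegral_const_mul' _ _ ENNReal.ofReal_ne_top,
          lintegral_mul_const' _ _ ENNReal.ofReal_ne_top, hmean r hr]
        ring

theorem intervalIntegrable_of_whatPos {ω : ℂ → ℝ} (hωp : WhatPos ω) :
    IntervalIntegrable (fun s : ℝ => ω (s : ℂ)) volume 0 1 := by
  by_contra h
  exact (hωp 0 le_rfl one_pos).ne' (intervalIntegral.integral_undef h)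

theorem what_sub_what {ω : ℂ → ℝ} (hωp : WhatPos ω) {r t : ℝ} (hr : 0 ≤ r) (hrt : r ≤ t)
    (ht : t ≤ 1) : what ω r - what ω t = ∫ s in r..t, ω (s : ℂ) := by
  have hint := intervalIntegrable_of_whatPos hωp
  have h1 : IntervalIntegrable (fun s : ℝ => ω (s : ℂ)) volume r t :=
    hint.mono_set (by
      rw [uIcc_of_le hrt, uIcc_of_le zero_le_one]
      exact Icc_subset_Icc hr ht)
  have h2 : IntervalIntegrable (fun s : ℝ => ω (s : ℂ)) volume t 1 :=
    hint.mono_set (by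
      rw [uIcc_of_le ht, uIcc_of_le zero_le_one]
      exact Icc_subset_Icc (hr.trans hrt) le_rfl)
  rw [what, what, sub_eq_iff_eq_add, intervalIntegral.integral_add_adjacent_intervals h1 h2]

theorem what_le_what {ω : ℂ → ℝ} (hω : RadialWeight ω) (hωp : WhatPos ω) {r t : ℝ} (hr : 0 ≤ r)
    (hrt : r ≤ t) (ht : t ≤ 1) : what ω t ≤ what ω r := by
  have h1 := what_sub_what hωp hr hrt ht
  have h2 : 0 ≤ ∫ s in r..t, ω (s : ℂ) :=
    intervalIntegral.integral_nonneg hrt fun s _ => hω.1 s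
  linarith

theorem setLIntegral_Ioc_eq_what_sub_what {ω : ℂ → ℝ} (hω : RadialWeight ω) (hωp : WhatPos ω)
    {r t : ℝ} (hr : 0 ≤ r) (hrt : r ≤ t) (ht : t ≤ 1) :
    ∫⁻ s in Ioc r t, ENNReal.ofReal (ω (s : ℂ)) = ENNReal.ofReal (what ω r - what ω t) := by
  have hint := intervalIntegrable_of_whatPos hωp
  rw [intervalIntegrable_iff_integrableOn_Ioc_of_le zero_le_one] at hint
  rw [what_sub_what hωp hr hrt ht, intervalIntegral.integral_of_le hrt,
    ofReal_integral_eq_lintegral_ofReal (hint.mono_set (Ioc_subset_Ioc hr ht))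
      (ae_of_all _ fun s => hω.1 _)]

/-- Lemma 2.5: for `0<p<∞`, `ω ∈ D` with `Ď`-exponent `α` and `κ > −α`,
`∫_𝔻 |f|^p (1−|z|)^κ ω dA ≍ ∫_𝔻 |f|^p (1−|z|)^{κ−1} ω̂ dA` for all analytic `f`. -/
theorem weight_replacement (p : ℝ) (hp : 0 < p)
    (ω : ℂ → ℝ) (hω : RadialWeight ω) (hωp : WhatPos ω) (hωD : Dclass ω)
    (α : ℝ) (hα : 0 < α) (hαexp : DcheckExp ω α) (κ : ℝ) (hκ : -α < κ) :
    ∃ C ≥ (1 : ℝ), ∀ f : ℂ → ℂ, DifferentiableOn ℂ f UD →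
      (∫⁻ z in UD, ENNReal.ofReal (‖f z‖ ^ p * (1 - ‖z‖) ^ (κ - 1) * what ω ‖z‖) ∂dA) ≤
          ENNReal.ofReal C *
            ∫⁻ z in UD, ENNReal.ofReal (‖f z‖ ^ p * (1 - ‖z‖) ^ κ * ω z) ∂dA ∧
      (∫⁻ z in UD, ENNReal.ofReal (‖f z‖ ^ p * (1 - ‖z‖) ^ κ * ω z) ∂dA) ≤
          ENNReal.ofReal C *
            ∫⁻ z in UD, ENNReal.ofReal (‖f z‖ ^ p * (1 - ‖z‖) ^ (κ - 1) * what ω ‖z‖) ∂dA := by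
  obtain ⟨⟨C₁, hC₁, hhat⟩, K, hK, C₂, hC₂, hcheck⟩ := hωD
  have hint := intervalIntegrable_of_whatPos hωp
  rw [intervalIntegrable_iff_integrableOn_Ioc_of_le zero_le_one] at hint
  have hωm : AEMeasurable (fun s : ℝ => ω (s : ℂ)) (volume.restrict (Ioo 0 1)) :=
    (hint.mono_set Ioo_subset_Ioc_self).aestronglyMeasurable.aemeasurable
  have hanti : AntitoneOn (what ω) (Ioo 0 1) := fun r hr t ht hrt =>
    what_le_what hω hωp hr.1.le hrt ht.2.le
  have hwm := aemeasurable_restrict_of_antitoneOn (μ := volume) measurableSet_Ioo hanti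
  have hpow : ∀ e : ℝ, AEMeasurable (fun r : ℝ => (1 - r) ^ e) (volume.restrict (Ioo 0 1)) :=
    fun e => by fun_prop
  have hratio : 0 < C₂ / (C₂ - 1) := div_pos (by linarith) (by linarith)
  have hH₁ : ∀ r ∈ Ioo (0 : ℝ) 1, ENNReal.ofReal (what ω r) ≤ ENNReal.ofReal (C₂ / (C₂ - 1)) *
      ∫⁻ s in Ioc r (1 - (1 - r) / K), ENNReal.ofReal (ω (s : ℂ)) := by
    intro r hr
    have hr1 : 0 < 1 - r := sub_pos.2 hr.2
    have h1 : (1 - r) / K ≤ 1 - r := div_le_self hr1.le hK.le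
    have h2 : 0 < (1 - r) / K := div_pos hr1 (by linarith)
    rw [setLIntegral_Ioc_eq_what_sub_what hω hωp hr.1.le (by linarith) (by linarith),
      ← ENNReal.ofReal_mul hratio.le]
    refine ENNReal.ofReal_le_ofReal ?_
    rw [div_mul_eq_mul_div, le_div_iff₀ (by linarith)]
    linarith [hcheck r hr.1.le hr.2]
  have hH₂ : ∀ t ∈ Ioo (0 : ℝ) 1, ∫⁻ s in Ioc (max 0 (2 * t - 1)) 1, ENNReal.ofReal (ω (s : ℂ)) ≤
      ENNReal.ofReal C₁ * ENNReal.ofReal (what ω t) := by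
    intro t ht
    have h1 : max 0 (2 * t - 1) < 1 := max_lt one_pos (by linarith [ht.2])
    rw [setLIntegral_Ioc_eq_what_sub_what hω hωp (le_max_left (0 : ℝ) _) h1.le le_rfl,
      ← ENNReal.ofReal_mul (by linarith)]
    refine ENNReal.ofReal_le_ofReal ?_
    have h2 : what ω 1 = 0 := by simp [what]
    have h3 := hhat _ (le_max_left (0 : ℝ) (2 * t - 1)) h1
    have h4 : what ω ((1 + max 0 (2 * t - 1)) / 2) ≤ what ω t :=
      what_le_what hω hωp ht.1.le (by linarith [le_max_right (0 : ℝ) (2 * t - 1)]) (by linarith)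
    rw [h2, sub_zero]
    exact h3.trans (mul_le_mul_of_nonneg_left h4 (by linarith))
  set D₁ := C₂ / (C₂ - 1) * (max 1 (K ^ (κ - 1)) * (K - 1)) with hD₁
  set D₂ := C₁ * (2 * max 1 (2 ^ (κ - 1))) with hD₂
  refine ⟨max 1 (max D₁ D₂), le_max_left _ _, fun f hf => ?_⟩
  set N : ℝ → ℝ≥0∞ := fun r =>
    ENNReal.ofReal r * ENNReal.ofReal (Real.circleAverage (fun z => ‖f z‖ ^ p) 0 r) with hN
  have hNmono : MonotoneOn N (Ioo 0 1) := fun r hr s hs hrs =>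
    mul_le_mul' (ENNReal.ofReal_le_ofReal hrs)
      (ENNReal.ofReal_le_ofReal (circleAverage_norm_rpow_mono hf hp hr.1.le hrs hs.2))
  set c₀ := (ENNReal.ofReal Real.pi)⁻¹ * ENNReal.ofReal (2 * Real.pi)
  have hpolar : ∀ (e : ℝ) (g : ℝ → ℝ), AEMeasurable g (volume.restrict (Ioo 0 1)) →
      ∫⁻ z in UD, ENNReal.ofReal (‖f z‖ ^ p * (1 - ‖z‖) ^ e * g ‖z‖) ∂dA =
        c₀ * ∫⁻ r in Ioo 0 1, N r * (ENNReal.ofReal ((1 - r) ^ e) * ENNReal.ofReal (g r)) := by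
    intro e g hg
    simp only [mul_assoc]
    rw [lintegral_UD_norm_rpow_mul_radial hf hp (g := fun r => (1 - r) ^ e * g r) ((hpow e).mul hg)]
    congr 1
    refine setLIntegral_congr_fun measurableSet_Ioo fun r hr => ?_
    rw [ENNReal.ofReal_mul (Real.rpow_nonneg (sub_pos.2 hr.2).le e)]
  have hrad : ∫⁻ z in UD, ENNReal.ofReal (‖f z‖ ^ p * (1 - ‖z‖) ^ κ * ω z) ∂dA =
      c₀ * ∫⁻ r in Ioo 0 1, N r * (ENNReal.ofReal ((1 - r) ^ κ) * ENNReal.ofReal (ω (r : ℂ))) := by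
    rw [← hpolar κ _ hωm]
    refine lintegral_congr fun z => ?_
    rw [hω.2.1 z]
  rw [hpolar (κ - 1) _ hwm, hrad]
  constructor
  · have key := lintegral_tail_le_lintegral_density (k := κ) hNmono hωm.ennreal_ofReal hK
      ENNReal.ofReal_ne_top hH₁
    rw [← ENNReal.ofReal_mul hratio.le] at key
    rw [mul_left_comm]
    gcongr
    refine key.trans ?_
    gcongr
    exact (le_max_left _ _).trans (le_max_right _ _)
  · have key := lintegral_density_le_lintegral_tail (k := κ) hNmono hωm.ennreal_ofReal
      ENNReal.ofReal_ne_top hH₂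
    rw [← ENNReal.ofReal_mul (by linarith)] at key
    rw [mul_left_comm]
    gcongr
    refine key.trans ?_
    gcongr
    exact (le_max_right _ _).trans (le_max_right _ _)
end

section
/- Let 1 < q < ∞ and let ν ∈ D be a radial weight with ν̂ > 0 on [0,1). Then the maximal Bergman projection P⁺_ν(f)(z) = ∫_𝔻 |f(ζ)| |B^ν_z(ζ)| ν(ζ) dA(ζ) is bounded on L^q_ν: there is C > 0 such that ∥P⁺_ν(f)∥_{L^q_ν} ≤ C ∥f∥_{L^q_ν} for all f ∈ L^q_ν. -/
open MeasureTheory Set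
open scoped ENNReal ComplexConjugate

theorem norm_exp_I_mul_pow (θ : ℝ) (n : ℕ) : ‖Complex.exp (Complex.I * θ) ^ n‖ = 1 := by
  rw [norm_pow, mul_comm, Complex.norm_exp_ofReal_mul_I, one_pow]

theorem continuous_tsum_exp {c : ℕ → ℂ} (hc : Summable fun n => ‖c n‖) :
    Continuous fun θ : ℝ => ∑' n, c n * Complex.exp (Complex.I * θ) ^ n := by
  refine continuous_tsum (fun n => by fun_prop) hc fun n θ => ?_
  rw [norm_mul, norm_exp_I_mul_pow, mul_one]

theorem integral_exp_pow_mul_conj (n m : ℕ) :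
    ∫ θ in (-Real.pi)..Real.pi,
      Complex.exp (Complex.I * θ) ^ n * conj (Complex.exp (Complex.I * θ) ^ m)
      = if n = m then (2 * Real.pi : ℂ) else 0 := by
  have key : ∀ θ : ℝ, Complex.exp (Complex.I * θ) ^ n * conj (Complex.exp (Complex.I * θ) ^ m)
      = Complex.exp (((n : ℂ) - m) * Complex.I * θ) := by
    intro θ
    rw [map_pow, ← Complex.exp_conj, ← Complex.exp_nat_mul, ← Complex.exp_nat_mul,
      ← Complex.exp_add]
    congr 1
    simp only [map_mul, Complex.conj_I, Complex.conj_ofReal]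
    ring
  simp_rw [key]
  split_ifs with h
  · subst h
    simp
    ring
  · have h0 : ((n : ℂ) - m) * Complex.I ≠ 0 := by
      refine mul_ne_zero (sub_ne_zero.2 ?_) Complex.I_ne_zero
      exact_mod_cast h
    rw [integral_exp_mul_complex h0, div_eq_zero_iff]
    left
    rw [sub_eq_zero, Complex.exp_eq_exp_iff_exists_int]
    refine ⟨(n : ℤ) - m, ?_⟩
    push_cast
    ring

/-- Parseval's identity for an absolutely convergent power series on the unit circle. -/
theorem integral_norm_sq_tsum_exp {c : ℕ → ℂ} (hc : Summable fun n => ‖c n‖) :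
    ∫ θ in (-Real.pi)..Real.pi, ‖∑' n, c n * Complex.exp (Complex.I * θ) ^ n‖ ^ 2
      = 2 * Real.pi * ∑' n, ‖c n‖ ^ 2 := by
  have hs : ∀ θ : ℝ, Summable fun n => ‖c n * Complex.exp (Complex.I * θ) ^ n‖ := fun θ => by
    simpa [norm_mul, norm_exp_I_mul_pow] using hc
  have hs' : ∀ θ : ℝ, Summable fun n => ‖conj (c n * Complex.exp (Complex.I * θ) ^ n)‖ :=
    fun θ => by simpa only [Complex.norm_conj] using hs θ
  have hprod : Summable fun p : ℕ × ℕ => ‖c p.1‖ * ‖c p.2‖ :=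
    hc.mul_of_nonneg hc (fun _ => norm_nonneg _) (fun _ => norm_nonneg _)
  have H := intervalIntegral.hasSum_integral_of_dominated_convergence
    (a := -Real.pi) (b := Real.pi) (μ := volume)
    (F := fun (p : ℕ × ℕ) (θ : ℝ) => (c p.1 * Complex.exp (Complex.I * θ) ^ p.1) *
      conj (c p.2 * Complex.exp (Complex.I * θ) ^ p.2))
    (f := fun θ : ℝ => ((‖∑' n, c n * Complex.exp (Complex.I * θ) ^ n‖ ^ 2 : ℝ) : ℂ))
    (fun p _ => ‖c p.1‖ * ‖c p.2‖)
    (fun p => by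
      refine Continuous.aestronglyMeasurable ?_
      fun_prop)
    (fun p => ae_of_all _ fun θ _ => by
      rw [norm_mul, norm_mul, Complex.norm_conj, norm_mul, norm_exp_I_mul_pow,
        norm_exp_I_mul_pow, mul_one, mul_one])
    (ae_of_all _ fun θ _ => hprod) (by simp)
    (ae_of_all _ fun θ _ => by
      have h1 := tsum_mul_tsum_of_summable_norm (hs θ) (hs' θ)
      have h2 := (summable_mul_of_summable_norm (hs θ) (hs' θ)).hasSum
      rw [← h1, ← Complex.conj_tsum, Complex.mul_conj, Complex.normSq_eq_norm_sq] at h2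
      exact h2)
  have hF : ∀ p : ℕ × ℕ, ∫ θ in (-Real.pi)..Real.pi,
      (c p.1 * Complex.exp (Complex.I * θ) ^ p.1) *
        conj (c p.2 * Complex.exp (Complex.I * θ) ^ p.2)
      = if p.1 = p.2 then (2 * Real.pi : ℂ) * (c p.1 * conj (c p.2)) else 0 := by
    intro p
    have : ∀ θ : ℝ, (c p.1 * Complex.exp (Complex.I * θ) ^ p.1) *
        conj (c p.2 * Complex.exp (Complex.I * θ) ^ p.2) = (c p.1 * conj (c p.2)) *
        (Complex.exp (Complex.I * θ) ^ p.1 * conj (Complex.exp (Complex.I * θ) ^ p.2)) := by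
      intro θ
      rw [map_mul]
      ring
    simp_rw [this]
    rw [intervalIntegral.integral_const_mul, integral_exp_pow_mul_conj]
    split_ifs <;> ring
  simp_rw [hF] at H
  rw [intervalIntegral.integral_ofReal] at H
  have H2 := H.tsum_eq
  rw [H.summable.tsum_prod] at H2
  have H3 : ∀ n : ℕ, ∑' m : ℕ, (if n = m then (2 * Real.pi : ℂ) * (c n * conj (c m)) else 0)
      = ((2 * Real.pi * ‖c n‖ ^ 2 : ℝ) : ℂ) := by
    intro n
    rw [tsum_eq_single n]
    · rw [if_pos rfl, Complex.mul_conj, Complex.normSq_eq_norm_sq]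
      push_cast
      ring
    · intro m hm
      rw [if_neg (Ne.symm hm)]
  simp only [H3] at H2
  rw [← Complex.ofReal_tsum, tsum_mul_left] at H2
  exact_mod_cast H2.symm

theorem sq_le_norm_one_sub_exp_sq {θ : ℝ} (hθ : |θ| ≤ Real.pi) :
    (2 / Real.pi * θ) ^ 2 ≤ ‖1 - Complex.exp (Complex.I * θ)‖ ^ 2 := by
  have h : 2 / Real.pi * |θ / 2| ≤ |Real.sin (θ / 2)| := by
    refine Real.mul_abs_le_abs_sin ?_
    rw [abs_div, abs_two]
    linarith
  have h2 : ‖1 - Complex.exp (Complex.I * θ)‖ = 2 * |Real.sin (θ / 2)| := by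
    rw [norm_sub_rev, Complex.norm_exp_I_mul_ofReal_sub_one, norm_mul, Real.norm_two,
      Real.norm_eq_abs]
  have h3 : |2 / Real.pi * θ| ≤ ‖1 - Complex.exp (Complex.I * θ)‖ := by
    rw [h2, abs_mul, abs_of_pos (by positivity : 0 < 2 / Real.pi)]
    rw [abs_div, abs_two] at h
    linarith
  calc (2 / Real.pi * θ) ^ 2 = |2 / Real.pi * θ| ^ 2 := (sq_abs _).symm
    _ ≤ _ := by gcongr

/-- Summation by parts: multiplying a power series by `1 - w` differences its coefficients. -/
theorem one_sub_mul_tsum_pow {c : ℕ → ℂ} (hc : Summable fun n => ‖c n‖) (h0 : c 0 = 0)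
    (θ : ℝ) :
    (1 - Complex.exp (Complex.I * θ)) * ∑' n, c n * Complex.exp (Complex.I * θ) ^ n
      = Complex.exp (Complex.I * θ) *
        ∑' n, (c (n + 1) - c n) * Complex.exp (Complex.I * θ) ^ n := by
  set w := Complex.exp (Complex.I * θ) with hw
  have hs : Summable fun n => c n * w ^ n := by
    refine Summable.of_norm ?_
    simpa [norm_mul, hw, norm_exp_I_mul_pow] using hc
  have hs1 : Summable fun n => c (n + 1) * w ^ n := by
    refine Summable.of_norm ?_
    have := (summable_nat_add_iff 1).2 hc
    simpa [norm_mul, hw, norm_exp_I_mul_pow] using this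
  have e1 : ∑' n, c n * w ^ n = w * ∑' n, c (n + 1) * w ^ n := by
    rw [hs.tsum_eq_zero_add, h0, zero_mul, zero_add, ← tsum_mul_left]
    exact tsum_congr fun n => by ring
  have e2 : ∑' n, (c (n + 1) - c n) * w ^ n = ∑' n, c (n + 1) * w ^ n - ∑' n, c n * w ^ n := by
    rw [← hs1.tsum_sub hs]
    exact tsum_congr fun n => by ring
  rw [e2]
  linear_combination e1

theorem integral_inv_one_add_mul_sq_le {a : ℝ} (ha : 0 < a) (u v : ℝ) (huv : u ≤ v) :
    ∫ θ in u..v, (1 + (a * θ) ^ 2)⁻¹ ≤ Real.pi / a := by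
  have hi : Integrable fun θ : ℝ => (1 + (a * θ) ^ 2)⁻¹ :=
    integrable_inv_one_add_sq.comp_mul_left' ha.ne'
  calc ∫ θ in u..v, (1 + (a * θ) ^ 2)⁻¹ = ∫ θ in Ioc u v, (1 + (a * θ) ^ 2)⁻¹ :=
        intervalIntegral.integral_of_le huv
    _ ≤ ∫ θ, (1 + (a * θ) ^ 2)⁻¹ :=
        setIntegral_le_integral hi (ae_of_all _ fun θ => by positivity)
    _ = Real.pi / a := by
        rw [Measure.integral_comp_mul_left (fun x : ℝ => (1 + x ^ 2)⁻¹) a,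
          integral_univ_inv_one_add_sq, abs_of_pos (inv_pos.2 ha), smul_eq_mul]
        ring

theorem tsum_norm_sq_le_of_geometric {c : ℕ → ℂ} {V ρ : ℝ} (hρ0 : 0 ≤ ρ) (hρ1 : ρ < 1)
    (hc : ∀ n, ‖c n‖ ≤ V * ρ ^ n) : ∑' n, ‖c n‖ ^ 2 ≤ V ^ 2 * (1 - ρ ^ 2)⁻¹ := by
  have h2 : ρ ^ 2 < 1 := by nlinarith
  have hg := (hasSum_geometric_of_lt_one (sq_nonneg ρ) h2).mul_left (V ^ 2)
  have hle : ∀ n, ‖c n‖ ^ 2 ≤ V ^ 2 * (ρ ^ 2) ^ n := fun n => by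
    calc ‖c n‖ ^ 2 ≤ (V * ρ ^ n) ^ 2 := by gcongr; exact hc n
      _ = _ := by ring
  rw [← hg.tsum_eq]
  exact (Summable.of_nonneg_of_le (fun n => by positivity) hle hg.summable).tsum_le_tsum hle
    hg.summable

/-- An `L¹` bound for a power series on the unit circle whose coefficients live at frequencies
`≲ N` and vary at scale `N`. -/
theorem integral_norm_tsum_exp_le {c : ℕ → ℂ} {N V ρ R : ℝ} (hN : 0 < N) (hV : 0 < V)
    (hρ0 : 0 ≤ ρ) (hρ1 : ρ < 1) (hR : (1 - ρ ^ 2)⁻¹ ≤ R * N) (h0 : c 0 = 0)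
    (hc : ∀ n, ‖c n‖ ≤ V * ρ ^ n) (hd : ∀ n, ‖c (n + 1) - c n‖ ≤ V / N * ρ ^ n) :
    ∫ θ in (-Real.pi)..Real.pi, ‖∑' n, c n * Complex.exp (Complex.I * θ) ^ n‖
      ≤ (2 * Real.pi * R + Real.pi ^ 2 / 4) * V := by
  have hpi := Real.pi_pos
  have hg := summable_geometric_of_lt_one hρ0 hρ1
  have hcs : Summable fun n => ‖c n‖ :=
    Summable.of_nonneg_of_le (fun _ => norm_nonneg _) hc (hg.mul_left V)
  have hds : Summable fun n => ‖c (n + 1) - c n‖ :=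
    Summable.of_nonneg_of_le (fun _ => norm_nonneg _) hd (hg.mul_left (V / N))
  set G : ℝ → ℂ := fun θ => ∑' n, c n * Complex.exp (Complex.I * θ) ^ n with hG
  set H : ℝ → ℂ := fun θ => ∑' n, (c (n + 1) - c n) * Complex.exp (Complex.I * θ) ^ n with hH
  have hGc : Continuous G := continuous_tsum_exp hcs
  have hHc : Continuous H := continuous_tsum_exp hds
  have hA : ∫ θ in (-Real.pi)..Real.pi, ‖G θ‖ ^ 2 ≤ 2 * Real.pi * (V ^ 2 * (R * N)) := by
    rw [integral_norm_sq_tsum_exp hcs]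
    gcongr
    exact (tsum_norm_sq_le_of_geometric hρ0 hρ1 hc).trans (by gcongr)
  have hB : ∫ θ in (-Real.pi)..Real.pi, ‖H θ‖ ^ 2 ≤ 2 * Real.pi * ((V / N) ^ 2 * (R * N)) := by
    rw [integral_norm_sq_tsum_exp hds]
    gcongr
    exact (tsum_norm_sq_le_of_geometric hρ0 hρ1 hd).trans (by gcongr)
  have hHG : ∀ θ : ℝ, ‖1 - Complex.exp (Complex.I * θ)‖ * ‖G θ‖ = ‖H θ‖ := by
    intro θ
    have := congrArg norm (one_sub_mul_tsum_pow hcs h0 θ)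
    rwa [norm_mul, norm_mul, ← pow_one (Complex.exp (Complex.I * θ)), norm_exp_I_mul_pow, pow_one,
      one_mul] at this
  have hpt : ∀ θ ∈ Icc (-Real.pi) Real.pi, ‖G θ‖ ≤
      (2 * (V * N))⁻¹ * ‖G θ‖ ^ 2 + N / (2 * V) * ‖H θ‖ ^ 2
        + V * N / 2 * (1 + (2 * N / Real.pi * θ) ^ 2)⁻¹ := by
    intro θ hθ
    have h1 := sq_le_norm_one_sub_exp_sq (abs_le.2 hθ)
    rw [← hHG]
    set e := ‖1 - Complex.exp (Complex.I * θ)‖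
    set g := ‖G θ‖ with hg
    set w := 1 + N ^ 2 * e ^ 2 with hw
    have hw0 : 0 < w := by positivity
    have h2 : w⁻¹ ≤ (1 + (2 * N / Real.pi * θ) ^ 2)⁻¹ := by
      gcongr
      rw [hw]
      have : (2 * N / Real.pi * θ) ^ 2 = N ^ 2 * (2 / Real.pi * θ) ^ 2 := by ring
      rw [this]
      gcongr
    have h3 : g ≤ (2 * (V * N))⁻¹ * g ^ 2 * w + V * N / 2 * w⁻¹ := by
      have : (2 * (V * N))⁻¹ * g ^ 2 * w + V * N / 2 * w⁻¹ - g
          = (g * w - V * N) ^ 2 / (2 * (V * N) * w) := by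
        field_simp
        ring
      have h4 : 0 ≤ (g * w - V * N) ^ 2 / (2 * (V * N) * w) := by positivity
      linarith
    have h5 : (2 * (V * N))⁻¹ * g ^ 2 * w
        = (2 * (V * N))⁻¹ * g ^ 2 + N / (2 * V) * (e * g) ^ 2 := by
      rw [hw]
      field_simp
    rw [h5] at h3
    have h6 : V * N / 2 * w⁻¹ ≤ V * N / 2 * (1 + (2 * N / Real.pi * θ) ^ 2)⁻¹ := by gcongr
    linarith
  have hwc : Continuous fun θ : ℝ => (1 + (2 * N / Real.pi * θ) ^ 2)⁻¹ := by
    refine Continuous.inv₀ (by fun_prop) fun θ => by positivity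
  have hI := integral_inv_one_add_mul_sq_le (a := 2 * N / Real.pi) (by positivity)
    (-Real.pi) Real.pi (by linarith)
  have i1 : IntervalIntegrable (fun θ => (2 * (V * N))⁻¹ * ‖G θ‖ ^ 2) volume (-Real.pi) Real.pi :=
    Continuous.intervalIntegrable (by fun_prop) _ _
  have i2 : IntervalIntegrable (fun θ => N / (2 * V) * ‖H θ‖ ^ 2) volume (-Real.pi) Real.pi :=
    Continuous.intervalIntegrable (by fun_prop) _ _
  have i3 : IntervalIntegrable (fun θ => V * N / 2 * (1 + (2 * N / Real.pi * θ) ^ 2)⁻¹) volume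
      (-Real.pi) Real.pi := Continuous.intervalIntegrable (by fun_prop) _ _
  calc ∫ θ in (-Real.pi)..Real.pi, ‖G θ‖
      ≤ ∫ θ in (-Real.pi)..Real.pi, ((2 * (V * N))⁻¹ * ‖G θ‖ ^ 2 + N / (2 * V) * ‖H θ‖ ^ 2
        + V * N / 2 * (1 + (2 * N / Real.pi * θ) ^ 2)⁻¹) :=
        intervalIntegral.integral_mono_on (by linarith) (hGc.norm.intervalIntegrable _ _)
          ((i1.add i2).add i3) hpt
    _ = (2 * (V * N))⁻¹ * (∫ θ in (-Real.pi)..Real.pi, ‖G θ‖ ^ 2)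
        + N / (2 * V) * (∫ θ in (-Real.pi)..Real.pi, ‖H θ‖ ^ 2)
        + V * N / 2 * ∫ θ in (-Real.pi)..Real.pi, (1 + (2 * N / Real.pi * θ) ^ 2)⁻¹ := by
        rw [intervalIntegral.integral_add (i1.add i2) i3, intervalIntegral.integral_add i1 i2,
          intervalIntegral.integral_const_mul, intervalIntegral.integral_const_mul,
          intervalIntegral.integral_const_mul]
    _ ≤ (2 * (V * N))⁻¹ * (2 * Real.pi * (V ^ 2 * (R * N)))
        + N / (2 * V) * (2 * Real.pi * ((V / N) ^ 2 * (R * N)))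
        + V * N / 2 * (Real.pi / (2 * N / Real.pi)) := by gcongr
    _ = (2 * Real.pi * R + Real.pi ^ 2 / 4) * V := by
        field_simp
        ring

/-- The `L¹` norm of a power series on the unit circle is subadditive in the coefficients. -/
theorem integral_norm_tsum_exp_add_le {a b : ℕ → ℂ} (ha : Summable fun n => ‖a n‖)
    (hb : Summable fun n => ‖b n‖) :
    ∫ θ in (-Real.pi)..Real.pi, ‖∑' n, (a n + b n) * Complex.exp (Complex.I * θ) ^ n‖
      ≤ (∫ θ in (-Real.pi)..Real.pi, ‖∑' n, a n * Complex.exp (Complex.I * θ) ^ n‖)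
        + ∫ θ in (-Real.pi)..Real.pi, ‖∑' n, b n * Complex.exp (Complex.I * θ) ^ n‖ := by
  have hpi := Real.pi_pos
  have hab : Summable fun n => ‖a n + b n‖ :=
    Summable.of_nonneg_of_le (fun _ => norm_nonneg _) (fun n => norm_add_le _ _) (ha.add hb)
  have ia := ((continuous_tsum_exp ha).norm.intervalIntegrable (μ := volume) (-Real.pi) Real.pi)
  have ib := ((continuous_tsum_exp hb).norm.intervalIntegrable (μ := volume) (-Real.pi) Real.pi)
  rw [← intervalIntegral.integral_add ia ib]
  refine intervalIntegral.integral_mono_on (by linarith)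
    ((continuous_tsum_exp hab).norm.intervalIntegrable _ _) (ia.add ib) fun θ _ => ?_
  have hs : ∀ {c : ℕ → ℂ}, (Summable fun n => ‖c n‖) →
      Summable fun n => c n * Complex.exp (Complex.I * θ) ^ n := fun {c} hc =>
    Summable.of_norm (by simpa [norm_mul, norm_exp_I_mul_pow] using hc)
  simp_rw [add_mul]
  rw [(hs ha).tsum_add (hs hb)]
  exact norm_add_le _ _

/-- Increasing positive coefficients with at most polynomial growth, in difference form. -/
structure SlowlyGrowing (l : ℕ → ℝ) (D : ℝ) : Prop where
  pos : ∀ n, 0 < l n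
  mono : Monotone l
  nonneg : 0 ≤ D
  step : ∀ n : ℕ, 1 ≤ n → n * (l (n + 1) - l n) ≤ D * l n

namespace SlowlyGrowing

variable {l : ℕ → ℝ} {D : ℝ}

theorem exists_polynomial_bound (h : SlowlyGrowing l D) :
    ∃ p : ℕ, ∀ N n : ℕ, 1 ≤ N → N ≤ n → l n ≤ l N * ((n : ℝ) / N) ^ p := by
  obtain ⟨p, hp⟩ := exists_nat_ge D
  refine ⟨p, fun N n hN hn => ?_⟩
  have hN0 : (0 : ℝ) < N := by exact_mod_cast hN
  induction n, hn using Nat.le_induction with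
  | base => rw [div_self hN0.ne', one_pow, mul_one]
  | succ n hn ih =>
    have hn1 : 1 ≤ n := hN.trans hn
    have hn0 : (0 : ℝ) < n := by exact_mod_cast hn1
    have h1 : l (n + 1) ≤ l n * (1 + p * (1 / n)) := by
      have h2 := h.step n hn1
      have h3 : D * l n ≤ p * l n := by
        have := (h.pos n).le
        gcongr
      have h4 : l (n + 1) - l n ≤ p * l n / n := by
        rw [le_div_iff₀ hn0]
        linarith
      calc l (n + 1) ≤ l n + p * l n / n := by linarith
        _ = _ := by ring
    have h2 : 1 + (p : ℝ) * (1 / n) ≤ (1 + 1 / n) ^ p :=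
      one_add_mul_le_pow (by have : (0 : ℝ) ≤ 1 / n := by positivity
                             linarith) p
    calc l (n + 1) ≤ l n * (1 + p * (1 / n)) := h1
      _ ≤ (l N * ((n : ℝ) / N) ^ p) * (1 + 1 / n) ^ p := by
          have := (h.pos n).le
          gcongr
          have := (h.pos N).le
          positivity
      _ = l N * (((n + 1 : ℕ) : ℝ) / N) ^ p := by
          rw [mul_assoc, ← mul_pow]
          congr 2
          push_cast
          field_simp

theorem exists_exponential_bound (h : SlowlyGrowing l D) :
    ∃ Q ≥ (1 : ℝ), ∀ (N : ℕ) (s : ℝ), 1 ≤ N → 0 ≤ s → 1 / (2 * N) ≤ 1 - s →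
      ∀ n : ℕ, l n * s ^ n ≤ Q * l N * Real.exp (-(1 / (4 * N))) ^ n := by
  obtain ⟨p, hp⟩ := h.exists_polynomial_bound
  refine ⟨1 + 4 ^ p * p.factorial, by
    have : (0 : ℝ) ≤ 4 ^ p * p.factorial := by positivity
    linarith, fun N s hN hs hs1 n => ?_⟩
  have hN0 : (0 : ℝ) < N := by exact_mod_cast hN
  set x : ℝ := n / (4 * N) with hx
  have hx0 : 0 ≤ x := by positivity
  have e1 : Real.exp (-(1 / (4 * N))) ^ n = Real.exp (-x) := by
    rw [← Real.exp_nat_mul]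
    congr 1
    rw [hx]
    ring
  have e2 : s ^ n ≤ Real.exp (-x) * Real.exp (-x) := by
    have h1 : s ≤ Real.exp (-(1 / (2 * N))) := by
      have := Real.add_one_le_exp (-(1 / (2 * (N : ℝ))))
      linarith
    calc s ^ n ≤ Real.exp (-(1 / (2 * N))) ^ n := by gcongr
      _ = _ := by
        rw [← Real.exp_nat_mul, ← Real.exp_add]
        congr 1
        rw [hx]
        ring
  have e3 : l n ≤ l N * (1 + 4 ^ p * x ^ p) := by
    have hl := h.pos N
    rcases le_total n N with hn | hn
    · have h1 := h.mono hn
      have h2 : 0 ≤ l N * (4 ^ p * x ^ p) := by positivity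
      linarith
    · have h1 := hp N n hN hn
      have h2 : ((n : ℝ) / N) ^ p = 4 ^ p * x ^ p := by
        rw [← mul_pow, hx]
        congr 1
        field_simp
      rw [h2] at h1
      linarith
  have e4 : x ^ p ≤ p.factorial * Real.exp x := by
    have := Real.pow_div_factorial_le_exp x hx0 p
    rwa [div_le_iff₀' (by positivity)] at this
  have hl := h.pos N
  rw [e1]
  calc l n * s ^ n ≤ (l N * (1 + 4 ^ p * (p.factorial * Real.exp x))) *
        (Real.exp (-x) * Real.exp (-x)) := by
        have := (h.pos n).le
        gcongr
        exact e3.trans (by gcongr)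
    _ = l N * (Real.exp (-x) + 4 ^ p * p.factorial * (Real.exp x * Real.exp (-x))) *
        Real.exp (-x) := by ring
    _ ≤ l N * (1 + 4 ^ p * p.factorial * 1) * Real.exp (-x) := by
        have : Real.exp x * Real.exp (-x) = 1 := by rw [← Real.exp_add]; simp
        rw [this]
        gcongr
        exact Real.exp_le_one_iff.2 (by linarith)
    _ = _ := by ring

theorem summable_mul_pow (h : SlowlyGrowing l D) {s : ℝ} (hs : 0 ≤ s) (hs1 : s < 1) :
    Summable fun n => l n * s ^ n := by
  obtain ⟨Q, -, hQ⟩ := h.exists_exponential_bound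
  obtain ⟨N, hN⟩ := exists_nat_ge (1 / (2 * (1 - s)))
  have h1s : 0 < 1 - s := by linarith
  have hN0 : (0 : ℝ) < N := lt_of_lt_of_le (by positivity) hN
  have hb := hQ N s (by exact_mod_cast hN0) hs (by
    rw [div_le_iff₀ (by positivity)] at hN ⊢
    linarith)
  refine Summable.of_nonneg_of_le (fun n => mul_nonneg (h.pos n).le (by positivity)) hb ?_
  exact (summable_geometric_of_lt_one (Real.exp_pos _).le
    (Real.exp_lt_one_iff.mpr (by simp only [neg_lt_zero]; positivity))).mul_left _

/-- `L¹` bound for one smooth frequency block at scale `N`. -/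
theorem integral_norm_block_le (h : SlowlyGrowing l D) {ψ : ℕ → ℝ} {N : ℕ} {s Q : ℝ}
    (hN : 1 ≤ N) (hs : 0 ≤ s) (hs1 : s ≤ 1) (hsN : 1 - s ≤ 1 / N) (hQ0 : 0 < Q)
    (h0 : ψ 0 = 0) (hψ0 : ∀ n, 0 ≤ ψ n) (hψ1 : ∀ n, ψ n ≤ 1) (hψN : ∀ n, ψ n ≤ n / N)
    (hψd : ∀ n, |ψ (n + 1) - ψ n| ≤ 1 / N)
    (hQ : ∀ n, (ψ n ≠ 0 ∨ ψ (n + 1) ≠ 0) →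
      l n * s ^ n ≤ Q * Real.exp (-(1 / (4 * N))) ^ n) :
    ∫ θ in (-Real.pi)..Real.pi,
        ‖∑' n, ((ψ n * (l n * s ^ n) : ℝ) : ℂ) * Complex.exp (Complex.I * θ) ^ n‖
      ≤ (2 * Real.pi * 3 + Real.pi ^ 2 / 4) * ((2 + 2 * D) * Q) := by
  have hN0 : (0 : ℝ) < N := by exact_mod_cast hN
  have hD := h.nonneg
  set ρ := Real.exp (-(1 / (4 * (N : ℝ)))) with hρ
  have hρ0 : 0 < ρ := Real.exp_pos _
  have hρ1 : ρ < 1 := Real.exp_lt_one_iff.mpr (by simp only [neg_lt_zero]; positivity)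
  have hb0 : ∀ n, 0 ≤ l n * s ^ n := fun n => mul_nonneg (h.pos n).le (by positivity)
  have hc : ∀ n, ψ n * (l n * s ^ n) ≤ Q * ρ ^ n := by
    intro n
    by_cases hn : ψ n = 0
    · rw [hn, zero_mul]
      positivity
    · calc ψ n * (l n * s ^ n) ≤ 1 * (l n * s ^ n) := by
            gcongr
            · exact hb0 n
            · exact hψ1 n
        _ ≤ _ := by rw [one_mul]; exact hQ n (Or.inl hn)
  refine integral_norm_tsum_exp_le (N := N) (ρ := ρ) hN0 (by positivity) hρ0.le hρ1 ?_
    (by simp [h0]) (fun n => ?_) (fun n => ?_)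
  · have e1 : ρ ^ 2 * (1 + 1 / (2 * N)) ≤ 1 := by
      have h1 : ρ ^ 2 = Real.exp (-(1 / (2 * (N : ℝ)))) := by
        rw [hρ, ← Real.exp_nat_mul]
        congr 1
        push_cast
        ring
      have h2 := Real.add_one_le_exp (1 / (2 * (N : ℝ)))
      calc ρ ^ 2 * (1 + 1 / (2 * N)) ≤ ρ ^ 2 * Real.exp (1 / (2 * (N : ℝ))) := by
            gcongr
            linarith
        _ = 1 := by rw [h1, ← Real.exp_add]; simp
    have hN1 : (1 : ℝ) ≤ N := by exact_mod_cast hN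
    have e2 : ρ ^ 2 * (2 * N + 1) ≤ 2 * N := by
      have := mul_le_mul_of_nonneg_right e1 (by positivity : (0 : ℝ) ≤ 2 * N)
      have e : ρ ^ 2 * (1 + 1 / (2 * N)) * (2 * N) = ρ ^ 2 * (2 * N + 1) := by
        field_simp
      linarith
    rw [inv_le_iff_one_le_mul₀ (by nlinarith)]
    have : ρ ^ 2 ≤ 1 := by nlinarith
    nlinarith
  · rw [Complex.norm_real, Real.norm_eq_abs, abs_of_nonneg (mul_nonneg (hψ0 n) (hb0 n))]
    refine (hc n).trans ?_
    gcongr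
    nlinarith
  · rw [← Complex.ofReal_sub, Complex.norm_real, Real.norm_eq_abs]
    by_cases hz : ψ n ≠ 0 ∨ ψ (n + 1) ≠ 0
    · have hbn := hQ n hz
      rcases Nat.eq_zero_or_pos n with rfl | hn
      · rw [h0, zero_mul, sub_zero, abs_of_nonneg (mul_nonneg (hψ0 _) (hb0 _))]
        have h2 := hQ 1 (Or.inl (by simpa [h0] using hz))
        rw [pow_one] at h2
        calc ψ (0 + 1) * (l (0 + 1) * s ^ (0 + 1)) ≤ (1 / N) * (Q * 1) := by
              have h3 := hψN 1
              rw [Nat.cast_one] at h3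
              rw [zero_add]
              have h4 := hb0 1
              refine mul_le_mul h3 ?_ h4 (by positivity)
              rw [pow_one]
              exact h2.trans (by rw [pow_one]; gcongr)
          _ ≤ (2 + 2 * D) * Q / N * ρ ^ 0 := by
              rw [pow_zero]
              have : 0 ≤ Q / N := by positivity
              have e : (2 + 2 * D) * Q / N * 1 - 1 / N * (Q * 1) = (1 + 2 * D) * (Q / N) := by
                ring
              have : 0 ≤ (1 + 2 * D) * (Q / N) := by positivity
              linarith
      · have hn0 : (0 : ℝ) < n := by exact_mod_cast hn
        set b := l n * s ^ n with hb
        have hbp := hb0 n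
        have hln := (h.pos n).le
        have hst : l (n + 1) - l n ≤ D / n * l n := by
          have := h.step n hn
          rw [div_mul_eq_mul_div, le_div_iff₀ hn0]
          linarith
        have hst0 : 0 ≤ l (n + 1) - l n := sub_nonneg.2 (h.mono (Nat.le_succ n))
        have hn1 : (1 : ℝ) ≤ n := by exact_mod_cast hn
        have hDn : D / n ≤ D := div_le_self hD hn1
        have hb1 : l (n + 1) * s ^ (n + 1) ≤ (1 + D) * b := by
          calc l (n + 1) * s ^ (n + 1) ≤ ((1 + D) * l n) * s ^ n := by
                have e1 : l (n + 1) ≤ (1 + D) * l n := by nlinarith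
                have e2 : s ^ (n + 1) ≤ s ^ n := pow_le_pow_of_le_one hs hs1 (Nat.le_succ n)
                gcongr
            _ = _ := by rw [hb]; ring
        have hdb : |l (n + 1) * s ^ (n + 1) - b| ≤ (D / n + 1 / N) * b := by
          have e : l (n + 1) * s ^ (n + 1) - b
              = s * (l (n + 1) - l n) * s ^ n - (1 - s) * b := by rw [hb]; ring
          rw [e]
          have e1 : 0 ≤ s * (l (n + 1) - l n) * s ^ n := by positivity
          have e2 : s * (l (n + 1) - l n) * s ^ n ≤ 1 * (D / n * l n) * s ^ n := by gcongr
          have e3 : 0 ≤ (1 - s) * b := mul_nonneg (by linarith) hbp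
          have e4 : (1 - s) * b ≤ 1 / N * b := by gcongr
          have e5 : 1 * (D / n * l n) * s ^ n = D / n * b := by rw [hb]; ring
          have e6 : 0 ≤ D / n * b := by positivity
          have e7 : 0 ≤ 1 / N * b := by positivity
          rw [add_mul, abs_le]
          constructor <;> linarith
        have e : ψ (n + 1) * (l (n + 1) * s ^ (n + 1)) - ψ n * b
            = (ψ (n + 1) - ψ n) * (l (n + 1) * s ^ (n + 1))
              + ψ n * (l (n + 1) * s ^ (n + 1) - b) := by ring
        rw [e]
        have hψn : ψ n * (D / n + 1 / N) ≤ D / N + 1 / N := by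
          rw [mul_add]
          refine add_le_add ?_ ?_
          · calc ψ n * (D / n) ≤ n / N * (D / n) := by gcongr; exact hψN n
              _ = D / N := by field_simp
          · calc ψ n * (1 / N) ≤ 1 * (1 / N) := by gcongr; exact hψ1 n
              _ = _ := one_mul _
        calc |(ψ (n + 1) - ψ n) * (l (n + 1) * s ^ (n + 1))
              + ψ n * (l (n + 1) * s ^ (n + 1) - b)|
            ≤ |ψ (n + 1) - ψ n| * (l (n + 1) * s ^ (n + 1))
              + ψ n * |l (n + 1) * s ^ (n + 1) - b| := by
              refine (abs_add_le _ _).trans_eq ?_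
              rw [abs_mul (ψ (n + 1) - ψ n), abs_mul (ψ n), abs_of_nonneg (hb0 (n + 1)),
                abs_of_nonneg (hψ0 n)]
          _ ≤ 1 / N * ((1 + D) * b) + ψ n * ((D / n + 1 / N) * b) := by
              have := hψ0 n
              have := hb0 (n + 1)
              gcongr
              exact hψd n
          _ = 1 / N * ((1 + D) * b) + (ψ n * (D / n + 1 / N)) * b := by ring
          _ ≤ 1 / N * ((1 + D) * b) + (D / N + 1 / N) * b := by gcongr
          _ = (2 + 2 * D) / N * b := by ring
          _ ≤ (2 + 2 * D) / N * (Q * ρ ^ n) := by gcongr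
          _ = _ := by ring
    · push Not at hz
      rw [hz.1, hz.2]
      simp only [zero_mul, sub_zero, abs_zero]
      positivity

end SlowlyGrowing

/-- The ramp `min(1, n / 2^j)`. -/
noncomputable def dyadicRamp (j n : ℕ) : ℝ := min 1 ((n : ℝ) / 2 ^ j)

theorem dyadicRamp_zero (j : ℕ) : dyadicRamp j 0 = 0 := by simp [dyadicRamp]

theorem dyadicRamp_nonneg (j n : ℕ) : 0 ≤ dyadicRamp j n := le_min zero_le_one (by positivity)

theorem dyadicRamp_le_one (j n : ℕ) : dyadicRamp j n ≤ 1 := min_le_left _ _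

theorem dyadicRamp_le_div (j n : ℕ) : dyadicRamp j n ≤ n / 2 ^ j := min_le_right _ _

theorem dyadicRamp_eq_one {j n : ℕ} (h : 2 ^ j ≤ n) : dyadicRamp j n = 1 := by
  refine min_eq_left ?_
  rw [le_div_iff₀ (by positivity), one_mul]
  exact_mod_cast h

theorem dyadicRamp_succ_le (j n : ℕ) : dyadicRamp (j + 1) n ≤ dyadicRamp j n := by
  refine min_le_min_left _ ?_
  gcongr
  · norm_num
  · omega

theorem dyadicRamp_le_succ (j n : ℕ) : dyadicRamp j n ≤ dyadicRamp j (n + 1) := by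
  refine min_le_min_left _ ?_
  gcongr
  omega

theorem dyadicRamp_succ_sub_le (j n : ℕ) :
    dyadicRamp j (n + 1) - dyadicRamp j n ≤ 1 / 2 ^ j := by
  have h1 := dyadicRamp_le_one j (n + 1)
  have h2 := dyadicRamp_le_div j (n + 1)
  have h3 : (0 : ℝ) ≤ 1 / 2 ^ j := by positivity
  have h4 : (((n + 1 : ℕ) : ℝ)) / 2 ^ j = n / 2 ^ j + 1 / 2 ^ j := by push_cast; ring
  rcases min_cases (1 : ℝ) ((n : ℝ) / 2 ^ j) with h | h
  · rw [dyadicRamp.eq_1 j n, h.1]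
    linarith
  · rw [dyadicRamp.eq_1 j n, h.1]
    linarith

namespace SlowlyGrowing

variable {l : ℕ → ℝ} {D : ℝ}

theorem integral_norm_dyadic_difference_le (h : SlowlyGrowing l D) {s : ℝ} {j J : ℕ}
    (hs : 0 ≤ s) (hs1 : s ≤ 1) (hsJ : 1 - s ≤ 1 / 2 ^ J) (hj : j < J) :
    ∫ θ in (-Real.pi)..Real.pi, ‖∑' n, (((dyadicRamp j n - dyadicRamp (j + 1) n) *
        (l n * s ^ n) : ℝ) : ℂ) * Complex.exp (Complex.I * θ) ^ n‖
      ≤ (2 * Real.pi * 3 + Real.pi ^ 2 / 4) * ((2 + 2 * D) * (2 * l (2 ^ (j + 1)))) := by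
  have hl := h.pos (2 ^ (j + 1))
  have h2j : (((2 ^ j : ℕ) : ℝ)) = 2 ^ j := by push_cast; rfl
  refine h.integral_norm_block_le (N := 2 ^ j) Nat.one_le_two_pow hs hs1 ?_ (by positivity) ?_
    (fun n => ?_) (fun n => ?_) (fun n => ?_) (fun n => ?_) (fun n hn => ?_)
  · rw [h2j]
    refine hsJ.trans ?_
    gcongr
    norm_num
  · simp [dyadicRamp_zero]
  · exact sub_nonneg.2 (dyadicRamp_succ_le j n)
  · linarith [dyadicRamp_le_one j n, dyadicRamp_nonneg (j + 1) n]
  · rw [h2j]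
    linarith [dyadicRamp_le_div j n, dyadicRamp_nonneg (j + 1) n]
  · rw [h2j]
    have h1 := dyadicRamp_succ_sub_le j n
    have h2 := dyadicRamp_succ_sub_le (j + 1) n
    have h3 := dyadicRamp_le_succ j n
    have h4 := dyadicRamp_le_succ (j + 1) n
    have h5 : (1 : ℝ) / 2 ^ (j + 1) ≤ 1 / 2 ^ j := by
      gcongr
      · norm_num
      · omega
    rw [abs_le]
    constructor <;> linarith
  · have hn' : n < 2 ^ (j + 1) := by
      by_contra hcon
      push Not at hcon
      have hz : ∀ m, 2 ^ (j + 1) ≤ m → dyadicRamp j m - dyadicRamp (j + 1) m = 0 := by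
        intro m hm
        rw [dyadicRamp_eq_one hm,
          dyadicRamp_eq_one ((Nat.pow_le_pow_right two_pos (Nat.le_succ j)).trans hm), sub_self]
      rcases hn with hn | hn
      · exact hn (hz n hcon)
      · exact hn (hz (n + 1) (by omega))
    have h1 : l n * s ^ n ≤ l (2 ^ (j + 1)) * 1 := by
      have := (h.pos n).le
      gcongr
      · exact h.mono hn'.le
      · exact pow_le_one₀ hs hs1
    have h2 : 1 / 2 ≤ Real.exp (-(1 / (4 * ((2 ^ j : ℕ) : ℝ)))) ^ n := by
      rw [← Real.exp_nat_mul, h2j]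
      have h3 := Real.add_one_le_exp ((n : ℝ) * -(1 / (4 * 2 ^ j)))
      have h4 : (n : ℝ) ≤ 2 * 2 ^ j := by
        have : (n : ℝ) ≤ ((2 ^ (j + 1) : ℕ) : ℝ) := by exact_mod_cast hn'.le
        push_cast at this
        rw [pow_succ] at this
        linarith
      have h5 : (n : ℝ) * (1 / (4 * 2 ^ j)) ≤ 2 * 2 ^ j * (1 / (4 * 2 ^ j)) := by gcongr
      have h6 : (2 : ℝ) * 2 ^ j * (1 / (4 * 2 ^ j)) = 1 / 2 := by
        field_simp
        norm_num
      linarith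
    calc l n * s ^ n ≤ l (2 ^ (j + 1)) * 1 := h1
      _ = 2 * l (2 ^ (j + 1)) * (1 / 2) := by ring
      _ ≤ _ := by gcongr

/-- `L¹` norm on the circle of radius `s` of a power series with slowly growing coefficients. -/
theorem exists_integral_norm_le (h : SlowlyGrowing l D) :
    ∃ C > (0 : ℝ), ∀ (s : ℝ) (J : ℕ), 0 ≤ s → s < 1 → 1 - s ≤ 1 / 2 ^ J →
      1 / (2 * 2 ^ J) ≤ 1 - s →
      ∫ θ in (-Real.pi)..Real.pi,
        ‖∑' n, ((l n * s ^ n : ℝ) : ℂ) * Complex.exp (Complex.I * θ) ^ n‖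
      ≤ C * ∑ j ∈ Finset.range (J + 1), l (2 ^ j) := by
  have hpi := Real.pi_pos
  obtain ⟨Q, hQ1, hQ⟩ := h.exists_exponential_bound
  have hD := h.nonneg
  set A := (2 * Real.pi * 3 + Real.pi ^ 2 / 4) * (2 + 2 * D) with hA
  have hA0 : 0 < A := by positivity
  refine ⟨2 * Real.pi + 2 * A + A * Q, by positivity, fun s J hs hs1 hsJ hsJ' => ?_⟩
  have hb0 : ∀ n, 0 ≤ l n * s ^ n := fun n => mul_nonneg (h.pos n).le (by positivity)
  have hsum := h.summable_mul_pow hs hs1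
  set I : (ℕ → ℝ) → ℝ := fun ψ => ∫ θ in (-Real.pi)..Real.pi,
    ‖∑' n, ((ψ n * (l n * s ^ n) : ℝ) : ℂ) * Complex.exp (Complex.I * θ) ^ n‖ with hI
  have hsψ : ∀ ψ : ℕ → ℝ, (∀ n, |ψ n| ≤ 1) →
      Summable fun n => ‖((ψ n * (l n * s ^ n) : ℝ) : ℂ)‖ := by
    intro ψ hψ
    refine Summable.of_nonneg_of_le (fun _ => norm_nonneg _) (fun n => ?_) hsum
    rw [Complex.norm_real, Real.norm_eq_abs, abs_mul, abs_of_nonneg (hb0 n)]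
    calc |ψ n| * (l n * s ^ n) ≤ 1 * (l n * s ^ n) := by
          gcongr
          · exact hb0 n
          · exact hψ n
      _ = _ := one_mul _
  have hadd : ∀ ψ φ : ℕ → ℝ, (∀ n, |ψ n| ≤ 1) → (∀ n, |φ n| ≤ 1) →
      I (fun n => ψ n + φ n) ≤ I ψ + I φ := by
    intro ψ φ hψ hφ
    have := integral_norm_tsum_exp_add_le (hsψ ψ hψ) (hsψ φ hφ)
    simp only [← Complex.ofReal_add, ← add_mul] at this
    exact this
  have hramp : ∀ j n, |dyadicRamp j n| ≤ 1 := fun j n => by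
    rw [abs_of_nonneg (dyadicRamp_nonneg j n)]
    exact dyadicRamp_le_one j n
  have hdiff : ∀ j n, |dyadicRamp j n - dyadicRamp (j + 1) n| ≤ 1 := fun j n => by
    rw [abs_of_nonneg (sub_nonneg.2 (dyadicRamp_succ_le j n))]
    linarith [dyadicRamp_le_one j n, dyadicRamp_nonneg (j + 1) n]
  have hsteps : ∀ k, k ≤ J → I (dyadicRamp 0) ≤
      (∑ j ∈ Finset.range k, 2 * A * l (2 ^ (j + 1))) + I (dyadicRamp k) := by
    intro k
    induction k with
    | zero => intro _; simp
    | succ k ih =>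
      intro hk
      have h1 := ih (by omega)
      have h2 := hadd (fun n => dyadicRamp k n - dyadicRamp (k + 1) n) (dyadicRamp (k + 1))
        (hdiff k) (hramp (k + 1))
      simp only [sub_add_cancel] at h2
      have h3 := h.integral_norm_dyadic_difference_le hs hs1.le hsJ (Nat.lt_of_succ_le hk)
      have h4 : I (fun n => dyadicRamp k n - dyadicRamp (k + 1) n) ≤ 2 * A * l (2 ^ (k + 1)) :=
        h3.trans_eq (by rw [hA]; ring)
      rw [Finset.sum_range_succ]
      change I (fun n => dyadicRamp k n) ≤ _ at h2
      change I (dyadicRamp k) ≤ _ at h2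
      linarith
  have hlast : I (dyadicRamp J) ≤ A * Q * l (2 ^ J) := by
    have hl := h.pos (2 ^ J)
    have h2J : (((2 ^ J : ℕ) : ℝ)) = 2 ^ J := by push_cast; rfl
    have hQ' := hQ (2 ^ J) s Nat.one_le_two_pow hs (by rw [h2J]; exact hsJ')
    refine (h.integral_norm_block_le (N := 2 ^ J) (Q := Q * l (2 ^ J)) Nat.one_le_two_pow hs
      hs1.le (by rw [h2J]; exact hsJ) (by positivity) (dyadicRamp_zero J) (dyadicRamp_nonneg J)
      (dyadicRamp_le_one J) (fun n => by rw [h2J]; exact dyadicRamp_le_div J n) (fun n => ?_)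
      (fun n _ => hQ' n)).trans_eq (by rw [hA]; ring)
    rw [h2J, abs_of_nonneg (sub_nonneg.2 (dyadicRamp_le_succ J n))]
    exact dyadicRamp_succ_sub_le J n
  have hfirst : I (fun n => if n = 0 then 1 else 0) = 2 * Real.pi * l 0 := by
    have : ∀ θ : ℝ, ∑' n, (((if n = 0 then 1 else 0) * (l n * s ^ n) : ℝ) : ℂ) *
        Complex.exp (Complex.I * θ) ^ n = l 0 := by
      intro θ
      rw [tsum_eq_single 0 (fun n hn => by simp [hn])]
      simp
    simp only [hI, this, Complex.norm_real, Real.norm_eq_abs, abs_of_pos (h.pos 0)]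
    rw [intervalIntegral.integral_const, smul_eq_mul]
    ring
  have hall : I (fun _ => 1) ≤ 2 * Real.pi * l 0 + I (dyadicRamp 0) := by
    have := hadd (fun n => if n = 0 then 1 else 0) (dyadicRamp 0)
      (fun n => by split_ifs <;> simp) (hramp 0)
    rw [hfirst] at this
    refine le_trans (le_of_eq ?_) this
    congr 1
    funext n
    rcases Nat.eq_zero_or_pos n with rfl | hn
    · simp [dyadicRamp_zero]
    · rw [if_neg hn.ne', dyadicRamp_eq_one (by rw [pow_zero]; exact hn), zero_add]
  set S := ∑ j ∈ Finset.range (J + 1), l (2 ^ j) with hS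
  have hterm : ∀ j ≤ J, l (2 ^ j) ≤ S := fun j hj =>
    Finset.single_le_sum (f := fun j => l (2 ^ j)) (fun i _ => (h.pos _).le)
      (Finset.mem_range.2 (Nat.lt_succ_of_le hj))
  have hl0 : l 0 ≤ S := (h.mono (Nat.zero_le _)).trans (hterm 0 (Nat.zero_le _))
  have hmid : ∑ j ∈ Finset.range J, 2 * A * l (2 ^ (j + 1)) ≤ 2 * A * S := by
    rw [← Finset.mul_sum]
    gcongr
    rw [hS, Finset.sum_range_succ']
    linarith [h.pos (2 ^ 0)]
  have hfin := hsteps J le_rfl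
  have h1 : I (fun _ => 1) ≤ 2 * Real.pi * S + (2 * A * S + A * Q * S) := by
    have e1 : 2 * Real.pi * l 0 ≤ 2 * Real.pi * S := by gcongr
    have e2 : A * Q * l (2 ^ J) ≤ A * Q * S := by
      gcongr
      exact hterm J le_rfl
    linarith
  simp only [hI, one_mul] at h1
  linarith

end SlowlyGrowing

section RadialMeasure

variable {ν : ℂ → ℝ}

/-- The radial part of a weight, as a measure on `(0,1)`. -/
noncomputable def radialMeasure (ν : ℂ → ℝ) : Measure ℝ :=
  (volume.restrict (Ioo (0 : ℝ) 1)).withDensity fun r => ENNReal.ofReal (ν (r : ℂ))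

theorem RadialWeight.intervalIntegrable (hνp : WhatPos ν) :
    IntervalIntegrable (fun s : ℝ => ν (s : ℂ)) volume 0 1 := by
  by_contra h
  have := hνp 0 le_rfl one_pos
  rw [what, intervalIntegral.integral_undef h] at this
  exact lt_irrefl _ this

theorem intervalIntegrable_of_subset (hνp : WhatPos ν) {a b : ℝ} (ha : 0 ≤ a) (hab : a ≤ b)
    (hb : b ≤ 1) : IntervalIntegrable (fun s : ℝ => ν (s : ℂ)) volume a b := by
  refine (RadialWeight.intervalIntegrable hνp).mono_set ?_
  rw [uIcc_of_le hab, uIcc_of_le zero_le_one]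
  exact Icc_subset_Icc ha hb

theorem what_antitone (hν : RadialWeight ν) (hνp : WhatPos ν) {r t : ℝ} (hr : 0 ≤ r)
    (hrt : r ≤ t) (ht : t ≤ 1) : what ν t ≤ what ν r := by
  have h := intervalIntegral.integral_add_adjacent_intervals
    (intervalIntegrable_of_subset hνp hr hrt ht)
    (intervalIntegrable_of_subset hνp (hr.trans hrt) ht le_rfl)
  have h2 : 0 ≤ ∫ s in r..t, ν (s : ℂ) :=
    intervalIntegral.integral_nonneg hrt fun s _ => hν.1 _
  unfold what
  linarith

theorem aemeasurable_radial (hνp : WhatPos ν) :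
    AEMeasurable (fun r : ℝ => ENNReal.ofReal (ν (r : ℂ))) (volume.restrict (Ioo (0 : ℝ) 1)) := by
  have h := (intervalIntegrable_iff_integrableOn_Ioo_of_le zero_le_one).1
    (RadialWeight.intervalIntegrable hνp)
  exact h.aestronglyMeasurable.aemeasurable.ennreal_ofReal

theorem radialMeasure_Ici (hν : RadialWeight ν) (hνp : WhatPos ν) {u : ℝ} (hu : 0 ≤ u)
    (hu1 : u ≤ 1) : radialMeasure ν (Ici u) = ENNReal.ofReal (what ν u) := by
  rw [radialMeasure, withDensity_apply _ measurableSet_Ici, Measure.restrict_restrict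
    measurableSet_Ici, what, intervalIntegral.integral_of_le hu1,
    ofReal_integral_eq_lintegral_ofReal]
  · refine setLIntegral_congr ?_
    have h1 : (Ici u ∩ Ioo (0 : ℝ) 1 : Set ℝ) =ᵐ[volume] (Ioi u ∩ Ioc (0 : ℝ) 1 : Set ℝ) :=
      Ioi_ae_eq_Ici.symm.inter Ioo_ae_eq_Ioc
    refine h1.trans (ae_of_all _ fun x => ?_)
    refine propext ⟨fun h => ⟨h.1, h.2.2⟩, fun h => ⟨h.1, hu.trans_lt h.1, h.2⟩⟩
  · exact (intervalIntegrable_iff_integrableOn_Ioc_of_le hu1).1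
      (intervalIntegrable_of_subset hνp hu hu1 le_rfl)
  · exact ae_of_all _ fun x => hν.1 _

theorem radialMeasure_Ici_of_one_le {u : ℝ} (hu : 1 ≤ u) : radialMeasure ν (Ici u) = 0 := by
  rw [radialMeasure, withDensity_apply _ measurableSet_Ici, Measure.restrict_restrict
    measurableSet_Ici]
  have : Ici u ∩ Ioo (0 : ℝ) 1 = ∅ := by
    ext x
    simp only [mem_inter_iff, mem_Ici, mem_Ioo, mem_empty_iff_false, iff_false, not_and, not_lt]
    intro h _
    linarith
  rw [this]
  simp

theorem radialMeasure_ae_mem : ∀ᵐ r ∂(radialMeasure ν), r ∈ Ioo (0 : ℝ) 1 :=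
  (withDensity_absolutelyContinuous _ _).ae_le (ae_restrict_mem measurableSet_Ioo)

theorem intervalIntegrable_rpow_mul (hνp : WhatPos ν) {x : ℝ} (hx : 0 ≤ x) :
    IntervalIntegrable (fun t : ℝ => t ^ x * ν (t : ℂ)) volume 0 1 :=
  (RadialWeight.intervalIntegrable hνp).continuousOn_mul (Real.continuous_rpow_const hx).continuousOn

theorem ofReal_mom (hν : RadialWeight ν) (hνp : WhatPos ν) {x : ℝ} (hx : 0 ≤ x) :
    ENNReal.ofReal (mom ν x) = ∫⁻ t, ENNReal.ofReal (t ^ x) ∂(radialMeasure ν) := by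
  rw [radialMeasure, lintegral_withDensity_eq_lintegral_mul₀ (aemeasurable_radial hνp), mom,
    intervalIntegral.integral_of_le zero_le_one, integral_Ioc_eq_integral_Ioo,
    ofReal_integral_eq_lintegral_ofReal]
  · refine setLIntegral_congr_fun measurableSet_Ioo fun t ht => ?_
    simp only [Pi.mul_apply]
    rw [ENNReal.ofReal_mul (Real.rpow_nonneg ht.1.le _), mul_comm]
  · exact (intervalIntegrable_iff_integrableOn_Ioo_of_le zero_le_one).1
      (intervalIntegrable_rpow_mul hνp hx)
  · filter_upwards [ae_restrict_mem measurableSet_Ioo] with t ht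
    exact mul_nonneg (Real.rpow_nonneg ht.1.le _) (hν.1 _)
  · exact (Real.continuous_rpow_const hx).measurable.ennreal_ofReal.aemeasurable

theorem mom_antitone (hν : RadialWeight ν) (hνp : WhatPos ν) {x y : ℝ} (hx : 0 ≤ x)
    (hxy : x ≤ y) : mom ν y ≤ mom ν x := by
  refine intervalIntegral.integral_mono_on_of_le_Ioo zero_le_one
    (intervalIntegrable_rpow_mul hνp (hx.trans hxy)) (intervalIntegrable_rpow_mul hνp hx)
    fun t ht => ?_
  exact mul_le_mul_of_nonneg_right (Real.rpow_le_rpow_of_exponent_ge ht.1 ht.2.le hxy) (hν.1 _)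

theorem rpow_mul_what_le_mom (hν : RadialWeight ν) (hνp : WhatPos ν) {x r : ℝ} (hx : 0 ≤ x)
    (hr : 0 ≤ r) (hr1 : r ≤ 1) : r ^ x * what ν r ≤ mom ν x := by
  have hi := intervalIntegrable_rpow_mul hνp hx
  have hsub : ∀ {a b : ℝ}, 0 ≤ a → a ≤ b → b ≤ 1 →
      IntervalIntegrable (fun t : ℝ => t ^ x * ν (t : ℂ)) volume a b := by
    intro a b ha hab hb
    refine hi.mono_set ?_
    rw [uIcc_of_le hab, uIcc_of_le zero_le_one]
    exact Icc_subset_Icc ha hb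
  have h1 : 0 ≤ ∫ t in (0 : ℝ)..r, t ^ x * ν (t : ℂ) :=
    intervalIntegral.integral_nonneg hr fun t ht =>
      mul_nonneg (Real.rpow_nonneg ht.1 _) (hν.1 _)
  have h2 : r ^ x * what ν r ≤ ∫ t in r..1, t ^ x * ν (t : ℂ) := by
    rw [what, ← intervalIntegral.integral_const_mul]
    refine intervalIntegral.integral_mono_on hr1
      ((intervalIntegrable_of_subset hνp hr hr1 le_rfl).const_mul _) (hsub hr hr1 le_rfl)
      fun t ht => ?_
    exact mul_le_mul_of_nonneg_right (Real.rpow_le_rpow hr ht.1 hx) (hν.1 _)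
  have h3 := intervalIntegral.integral_add_adjacent_intervals (hsub le_rfl hr hr1)
    (hsub hr hr1 le_rfl)
  rw [mom]
  linarith

theorem mom_pos (hν : RadialWeight ν) (hνp : WhatPos ν) {x : ℝ} (hx : 0 ≤ x) : 0 < mom ν x := by
  refine lt_of_lt_of_le ?_
    (rpow_mul_what_le_mom hν hνp hx (r := 1 / 2) (by norm_num) (by norm_num))
  have := hνp (1 / 2) (by norm_num) (by norm_num)
  positivity

/-- Layer-cake form of the moments of a radial weight. -/
theorem ofReal_mom_eq_layercake (hν : RadialWeight ν) (hνp : WhatPos ν) {x : ℝ} (hx : 0 < x) :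
    ENNReal.ofReal (mom ν x) = ENNReal.ofReal x *
      ∫⁻ t in Ioi 0, radialMeasure ν (Ici t) * ENNReal.ofReal (t ^ (x - 1)) := by
  rw [ofReal_mom hν hνp hx.le]
  exact lintegral_rpow_eq_lintegral_meas_le_mul (radialMeasure ν) (f := fun t => t)
    (radialMeasure_ae_mem.mono fun t ht => ht.1.le) aemeasurable_id hx

/-- The moments of a weight in `D̂` are doubling. -/
theorem Dhat.exists_mom_le (hD : Dhat ν) (hν : RadialWeight ν) (hνp : WhatPos ν) :
    ∃ C > (0 : ℝ), ∀ x : ℝ, 1 ≤ x → mom ν x ≤ C * mom ν (2 * x - 1) := by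
  obtain ⟨C, hC, hCr⟩ := hD
  have hC0 : 0 < C := by linarith
  refine ⟨2 * C, by positivity, fun x hx => ?_⟩
  have hm := mom_pos hν hνp (x := 2 * x - 1) (by linarith)
  rw [← ENNReal.ofReal_le_ofReal_iff (by positivity), ENNReal.ofReal_mul (by positivity),
    ofReal_mom_eq_layercake hν hνp (by linarith : 0 < x),
    ofReal_mom_eq_layercake hν hνp (by linarith : 0 < 2 * x - 1)]
  set g : ℝ → ℝ≥0∞ := fun t => radialMeasure ν (Ici t) * ENNReal.ofReal (t ^ (x - 1)) with hg
  set k : ℝ → ℝ≥0∞ :=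
    fun t => radialMeasure ν (Ici t) * ENNReal.ofReal (t ^ (2 * x - 1 - 1)) with hk
  have h1 : ∫⁻ t in Ioi 0, g t ≤ ∫⁻ t in Ioo 0 1, g t := by
    have hsub : (Ioi (0 : ℝ)) = Ioo 0 1 ∪ Ici 1 := by
      ext t
      simp only [mem_Ioi, mem_union, mem_Ioo, mem_Ici]
      constructor
      · intro h
        rcases lt_or_ge t 1 with h1 | h1
        · exact Or.inl ⟨h, h1⟩
        · exact Or.inr h1
      · rintro (h | h) <;> linarith
    have hz : ∫⁻ t in Ici (1 : ℝ), g t = 0 := by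
      rw [setLIntegral_congr_fun (g := fun _ => 0) measurableSet_Ici (fun t ht => by
        simp only [hg, radialMeasure_Ici_of_one_le ht, zero_mul])]
      simp
    calc ∫⁻ t in Ioi 0, g t ≤ (∫⁻ t in Ioo 0 1, g t) + ∫⁻ t in Ici (1 : ℝ), g t := by
          rw [hsub]
          exact lintegral_union_le _ _ _
      _ = _ := by rw [hz, add_zero]
  have h2 : ∫⁻ t in Ioo 0 1, g t
      = ∫⁻ v in Ioo (1 / 2 : ℝ) 1, ENNReal.ofReal |2| * g (2 * v - 1) := by
    have himg : (fun v : ℝ => 2 * v - 1) '' Ioo (1 / 2) 1 = Ioo 0 1 := by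
      ext t
      simp only [mem_image, mem_Ioo]
      constructor
      · rintro ⟨v, hv, rfl⟩
        constructor <;> linarith
      · intro ht
        exact ⟨(t + 1) / 2, by constructor <;> linarith, by ring⟩
    rw [← himg]
    refine lintegral_image_eq_lintegral_abs_deriv_mul (f' := fun _ => 2) measurableSet_Ioo
      (fun v _ => ?_) (fun a _ b _ hab => by simpa using hab) g
    simpa using (((hasDerivAt_id v).const_mul 2).sub_const 1).hasDerivWithinAt
  have h3 : ∀ v ∈ Ioo (1 / 2 : ℝ) 1, ENNReal.ofReal |2| * g (2 * v - 1)
      ≤ ENNReal.ofReal (2 * C) * k v := by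
    intro v hv
    have hM : radialMeasure ν (Ici (2 * v - 1)) ≤ ENNReal.ofReal C * radialMeasure ν (Ici v) := by
      rw [radialMeasure_Ici hν hνp (by linarith [hv.1]) (by linarith [hv.2]),
        radialMeasure_Ici hν hνp (by linarith [hv.1]) hv.2.le, ← ENNReal.ofReal_mul hC0.le]
      have := hCr (2 * v - 1) (by linarith [hv.1]) (by linarith [hv.2])
      rw [show (1 + (2 * v - 1)) / 2 = v by ring] at this
      exact ENNReal.ofReal_le_ofReal this
    have hp : (2 * v - 1) ^ (x - 1) ≤ v ^ (2 * x - 1 - 1) := by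
      have hv0 : 0 ≤ v := by linarith [hv.1]
      rw [show 2 * x - 1 - 1 = 2 * (x - 1) by ring, Real.rpow_mul hv0]
      refine Real.rpow_le_rpow (by linarith [hv.1]) ?_ (by linarith)
      rw [Real.rpow_two]
      nlinarith [sq_nonneg (v - 1)]
    calc ENNReal.ofReal |2| * g (2 * v - 1)
        ≤ ENNReal.ofReal 2 * ((ENNReal.ofReal C * radialMeasure ν (Ici v)) *
          ENNReal.ofReal (v ^ (2 * x - 1 - 1))) := by
          rw [abs_two]
          exact mul_le_mul' le_rfl (mul_le_mul' hM (ENNReal.ofReal_le_ofReal hp))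
      _ = _ := by
          rw [ENNReal.ofReal_mul zero_le_two, hk]
          ring
  have h4 : ∫⁻ t in Ioi 0, g t ≤ ENNReal.ofReal (2 * C) * ∫⁻ t in Ioi 0, k t := by
    rw [← lintegral_const_mul' _ _ ENNReal.ofReal_ne_top]
    refine h1.trans ?_
    rw [h2]
    refine (setLIntegral_mono' measurableSet_Ioo h3).trans (lintegral_mono_set fun v hv => ?_)
    exact lt_trans (by norm_num) hv.1
  calc ENNReal.ofReal x * ∫⁻ t in Ioi 0, g t
      ≤ ENNReal.ofReal (2 * x - 1) * (ENNReal.ofReal (2 * C) * ∫⁻ t in Ioi 0, k t) := by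
        gcongr
        linarith
    _ = _ := by ring

end RadialMeasure

section KernelMeans

variable {ν : ℂ → ℝ}

/-- The Taylor coefficients of the Bergman kernel. -/
noncomputable def kernelCoeff (ν : ℂ → ℝ) (n : ℕ) : ℝ := 1 / (2 * mom ν (2 * (n : ℝ) + 1))

theorem nat_mul_pow_mul_one_sub_le {t : ℝ} (ht : 0 ≤ t) (ht1 : t ≤ 1) (n : ℕ) :
    n * t ^ n * (1 - t) ≤ 1 := by
  have h1 : n * t ^ n ≤ ∑ k ∈ Finset.range n, t ^ k := by
    have : ∑ _k ∈ Finset.range n, t ^ n ≤ ∑ k ∈ Finset.range n, t ^ k :=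
      Finset.sum_le_sum fun k hk => pow_le_pow_of_le_one ht ht1 (Finset.mem_range.1 hk).le
    simpa using this
  calc n * t ^ n * (1 - t) ≤ (∑ k ∈ Finset.range n, t ^ k) * (1 - t) := by
        gcongr
    _ = 1 - t ^ n := geom_sum_mul_neg t n
    _ ≤ 1 := by linarith [pow_nonneg ht n]

theorem nat_mul_mom_le (hν : RadialWeight ν) (hνp : WhatPos ν) (n : ℕ) :
    n * mom ν (2 * (n : ℝ) + 1) ≤ n * mom ν (2 * ((n + 1 : ℕ) : ℝ) + 1) + 2 * mom ν (n + 1) := by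
  have hi : ∀ x : ℝ, 0 ≤ x → IntervalIntegrable (fun t : ℝ => t ^ x * ν (t : ℂ)) volume 0 1 :=
    fun x hx => intervalIntegrable_rpow_mul hνp hx
  have ha := hi (2 * (n : ℝ) + 1) (by positivity)
  have hb := hi (2 * ((n + 1 : ℕ) : ℝ) + 1) (by positivity)
  have hc := hi ((n : ℝ) + 1) (by positivity)
  simp only [mom]
  rw [← intervalIntegral.integral_const_mul, ← intervalIntegral.integral_const_mul,
    ← intervalIntegral.integral_const_mul,
    ← intervalIntegral.integral_add (hb.const_mul _) (hc.const_mul _)]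
  refine intervalIntegral.integral_mono_on zero_le_one (ha.const_mul _)
    ((hb.const_mul _).add (hc.const_mul _)) fun t ht => ?_
  have h1 : t ^ (2 * (n : ℝ) + 1) = t ^ n * t ^ (n + 1) := by
    rw [show (2 * (n : ℝ) + 1) = ((2 * n + 1 : ℕ) : ℝ) by push_cast; ring, Real.rpow_natCast]
    ring
  have h2 : t ^ (2 * ((n + 1 : ℕ) : ℝ) + 1) = t ^ n * t ^ (n + 1) * t ^ 2 := by
    rw [show (2 * ((n + 1 : ℕ) : ℝ) + 1) = ((2 * n + 3 : ℕ) : ℝ) by push_cast; ring,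
      Real.rpow_natCast]
    ring
  have h3 : t ^ ((n : ℝ) + 1) = t ^ (n + 1) := by
    rw [show (n : ℝ) + 1 = ((n + 1 : ℕ) : ℝ) by push_cast; ring, Real.rpow_natCast]
  have h4 := nat_mul_pow_mul_one_sub_le ht.1 ht.2 n
  have h5 : n * t ^ n * (1 - t ^ 2) ≤ 2 := by
    calc n * t ^ n * (1 - t ^ 2) = (n * t ^ n * (1 - t)) * (1 + t) := by ring
      _ ≤ 1 * (1 + t) := by
        gcongr
        linarith [ht.1]
      _ ≤ 2 := by linarith [ht.2]
  rw [h1, h2, h3]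
  have h6 : 0 ≤ t ^ (n + 1) * ν (t : ℂ) := mul_nonneg (pow_nonneg ht.1 _) (hν.1 _)
  nlinarith [mul_le_mul_of_nonneg_right h5 h6]

theorem exists_slowlyGrowing_kernelCoeff (hν : RadialWeight ν) (hνp : WhatPos ν) (hD : Dhat ν) :
    ∃ D, SlowlyGrowing (kernelCoeff ν) D := by
  obtain ⟨C, hC, hCm⟩ := hD.exists_mom_le hν hνp
  have hpos : ∀ n : ℕ, 0 < mom ν (2 * (n : ℝ) + 1) := fun n => mom_pos hν hνp (by positivity)
  refine ⟨2 * C ^ 2, fun n => ?_, ?_, by positivity, fun n hn => ?_⟩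
  · have := hpos n
    rw [kernelCoeff]
    positivity
  · refine monotone_nat_of_le_succ fun n => ?_
    have := hpos (n + 1)
    unfold kernelCoeff
    gcongr
    exact mom_antitone hν hνp (by positivity) (by push_cast; linarith)
  · have hn' : (1 : ℝ) ≤ n := by exact_mod_cast hn
    have h0 := hpos n
    have h1 := hpos (n + 1)
    have h2 := nat_mul_mom_le hν hνp n
    have h3 : mom ν ((n : ℝ) + 1) ≤ C ^ 2 * mom ν (2 * ((n + 1 : ℕ) : ℝ) + 1) := by
      have e1 := hCm ((n : ℝ) + 1) (by linarith)
      have e2 := hCm (2 * (n : ℝ) + 1) (by linarith)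
      have e3 : mom ν (2 * (2 * (n : ℝ) + 1) - 1) ≤ mom ν (2 * ((n + 1 : ℕ) : ℝ) + 1) :=
        mom_antitone hν hνp (by positivity) (by push_cast; linarith)
      rw [show 2 * ((n : ℝ) + 1) - 1 = 2 * (n : ℝ) + 1 by ring] at e1
      calc _ ≤ C * mom ν (2 * (n : ℝ) + 1) := e1
        _ ≤ C * (C * mom ν (2 * ((n + 1 : ℕ) : ℝ) + 1)) := by
          gcongr
          exact e2.trans (by gcongr)
        _ = _ := by ring
    unfold kernelCoeff
    set a := mom ν (2 * (n : ℝ) + 1)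
    set b := mom ν (2 * ((n + 1 : ℕ) : ℝ) + 1)
    have h4 : (n : ℝ) * (1 / (2 * b) - 1 / (2 * a)) = (n * a - n * b) / (2 * a * b) := by
      field_simp
    have h5 : 2 * C ^ 2 * (1 / (2 * a)) = (2 * C ^ 2 * b) / (2 * a * b) := by
      field_simp
    rw [h4, h5]
    gcongr
    linarith

theorem kernelCoeff_two_pow_le (hν : RadialWeight ν) (hνp : WhatPos ν) (j : ℕ) :
    kernelCoeff ν (2 ^ j) ≤ 4 / what ν (1 - (1 / 2) ^ (j + 1)) := by
  set N : ℕ := 2 ^ j with hN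
  have hN1 : (1 : ℝ) ≤ N := by exact_mod_cast Nat.one_le_two_pow
  have hr : (1 : ℝ) - (1 / 2) ^ (j + 1) = 1 - 1 / (2 * N) := by
    rw [hN]
    push_cast
    rw [pow_succ, one_div_pow]
    field_simp
  rw [hr]
  set r : ℝ := 1 - 1 / (2 * N) with hrdef
  have hr2 : 1 / (2 * (N : ℝ)) ≤ 1 / 2 := by
    rw [div_le_div_iff_of_pos_left one_pos (by positivity) two_pos]
    linarith
  have hr0 : 1 / 2 ≤ r := by linarith
  have hr1 : r < 1 := by
    have : 0 < 1 / (2 * (N : ℝ)) := by positivity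
    linarith
  have hb : 1 / 2 ≤ r ^ N := by
    have h := one_add_mul_le_pow (a := -(1 / (2 * (N : ℝ)))) (by linarith) N
    have e : 1 + (N : ℝ) * -(1 / (2 * (N : ℝ))) = 1 / 2 := by
      field_simp
      norm_num
    rw [e] at h
    simpa [hrdef, sub_eq_add_neg] using h
  have hc : 1 / 8 ≤ r ^ (2 * (N : ℝ) + 1) := by
    rw [show 2 * (N : ℝ) + 1 = ((N + N + 1 : ℕ) : ℝ) by push_cast; ring, Real.rpow_natCast,
      pow_succ, pow_add]
    calc (1 / 8 : ℝ) = (1 / 2) * (1 / 2) * (1 / 2) := by norm_num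
      _ ≤ _ := by gcongr
  have hw : 0 < what ν r := hνp r (by linarith) hr1
  have hm := rpow_mul_what_le_mom hν hνp (x := 2 * (N : ℝ) + 1) (by positivity)
    (by linarith : 0 ≤ r) hr1.le
  have hm2 : 1 / 8 * what ν r ≤ mom ν (2 * (N : ℝ) + 1) :=
    (mul_le_mul_of_nonneg_right hc hw.le).trans hm
  rw [kernelCoeff, div_le_div_iff₀ (by linarith) hw]
  linarith

/-- For a weight in `Ď` the dyadic values of `1 / ν̂` are summed by the last one. -/
theorem Dcheck.exists_sum_inv_what_le (hD : Dcheck ν) (hν : RadialWeight ν) (hνp : WhatPos ν) :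
    ∃ C > (0 : ℝ), ∀ J : ℕ, ∑ j ∈ Finset.range (J + 1), 1 / what ν (1 - (1 / 2) ^ j)
      ≤ C * (1 / what ν (1 - (1 / 2) ^ J)) := by
  obtain ⟨K, hK, C, hC, hCr⟩ := hD
  obtain ⟨m, hm⟩ := pow_unbounded_of_one_lt K (one_lt_two : (1 : ℝ) < 2)
  set a : ℕ → ℝ := fun j => 1 / what ν (1 - (1 / 2) ^ j) with ha
  have hmem : ∀ j : ℕ, 0 ≤ 1 - (1 / 2 : ℝ) ^ j ∧ 1 - (1 / 2 : ℝ) ^ j < 1 := fun j =>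
    ⟨by linarith [pow_le_one₀ (n := j) (by norm_num : (0 : ℝ) ≤ 1 / 2) (by norm_num)],
      by linarith [pow_pos (by norm_num : (0 : ℝ) < 1 / 2) j]⟩
  have hpos : ∀ j, 0 < what ν (1 - (1 / 2) ^ j) := fun j => hνp _ (hmem j).1 (hmem j).2
  have hapos : ∀ j, 0 < a j := fun j => one_div_pos.2 (hpos j)
  have hmono : Monotone a := by
    intro i j hij
    refine one_div_le_one_div_of_le (hpos j) (what_antitone hν hνp (hmem i).1 ?_ (hmem j).2.le)
    linarith [pow_le_pow_of_le_one (by norm_num : (0 : ℝ) ≤ 1 / 2) (by norm_num) hij]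
  have hstep : ∀ j, a j ≤ 1 / C * a (j + m) := by
    intro j
    have h1 := hCr (1 - (1 / 2) ^ j) (hmem j).1 (hmem j).2
    have hj : (0 : ℝ) < (1 / 2) ^ j := by positivity
    have h2 : what ν (1 - (1 / 2) ^ (j + m))
        ≤ what ν (1 - (1 - (1 - (1 / 2) ^ j)) / K) := by
      refine what_antitone hν hνp ?_ ?_ (hmem _).2.le
      · have : (1 - (1 - (1 / 2 : ℝ) ^ j)) / K ≤ (1 / 2) ^ j := by
          rw [sub_sub_cancel]
          exact div_le_self hj.le hK.le
        linarith [(hmem j).1]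
      · rw [sub_sub_cancel, pow_add, div_eq_mul_inv]
        have : (1 / 2 : ℝ) ^ m ≤ K⁻¹ := by
          rw [one_div, inv_pow]
          exact inv_anti₀ (by linarith) hm.le
        nlinarith
    have h3 : C * what ν (1 - (1 / 2) ^ (j + m)) ≤ what ν (1 - (1 / 2) ^ j) :=
      (mul_le_mul_of_nonneg_left h2 (by linarith)).trans h1
    simp only [ha]
    rw [one_div_mul_one_div]
    have := hpos (j + m)
    exact one_div_le_one_div_of_le (by positivity) h3
  have hθ : 1 / C < 1 := by
    rw [div_lt_one (by linarith)]
    exact hC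
  refine ⟨m / (1 - 1 / C) + 1, ?_, fun J => ?_⟩
  · have : 0 < 1 - 1 / C := by linarith
    positivity
  have hS : ∑ j ∈ Finset.range (J + 1), a j
      ≤ 1 / C * ∑ j ∈ Finset.range (J + 1), a j + m * a J := by
    have hle : ∀ j ∈ Finset.range (J + 1), a j
        ≤ 1 / C * (if j + m ≤ J then a (j + m) else 0) + (if j + m ≤ J then 0 else a J) := by
      intro j hj
      split_ifs with h
      · simpa using hstep j
      · simpa using hmono (Nat.lt_succ_iff.1 (Finset.mem_range.1 hj))
    refine (Finset.sum_le_sum hle).trans ?_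
    rw [Finset.sum_add_distrib, ← Finset.mul_sum]
    have hC0 : 0 ≤ 1 / C := by positivity
    refine add_le_add (mul_le_mul_of_nonneg_left ?_ hC0) ?_
    · rw [← Finset.sum_filter]
      calc _ = ∑ i ∈ ((Finset.range (J + 1)).filter fun j => j + m ≤ J).image (· + m), a i :=
            (Finset.sum_image fun x _ y _ hxy => Nat.add_right_cancel hxy).symm
        _ ≤ _ := by
          refine Finset.sum_le_sum_of_subset_of_nonneg ?_ fun i _ _ => (hapos i).le
          intro i hi
          obtain ⟨j, hj, rfl⟩ := Finset.mem_image.1 hi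
          exact Finset.mem_range.2 (Nat.lt_succ_of_le (Finset.mem_filter.1 hj).2)
    · have e : ∀ j, (if j + m ≤ J then 0 else a J) = if ¬ (j + m ≤ J) then a J else 0 := by
        intro j
        split_ifs <;> rfl
      simp only [e]
      rw [← Finset.sum_filter, Finset.sum_const, nsmul_eq_mul]
      refine mul_le_mul_of_nonneg_right ?_ (hapos J).le
      have : ((Finset.range (J + 1)).filter fun j => ¬ (j + m ≤ J)) ⊆
          Finset.Ico (J + 1 - m) (J + 1) := by
        intro j hj
        simp only [Finset.mem_filter, Finset.mem_range, Finset.mem_Ico] at hj ⊢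
        omega
      have hcard := Finset.card_le_card this
      rw [Nat.card_Ico] at hcard
      exact_mod_cast hcard.trans (by omega)
  have h1 : 0 < 1 - 1 / C := by linarith
  have h2 : ∑ j ∈ Finset.range (J + 1), a j ≤ m / (1 - 1 / C) * a J := by
    rw [div_mul_eq_mul_div, le_div_iff₀ h1]
    linarith
  have := (hapos J).le
  change _ ≤ _ * a J
  linarith

/-- The first integral means of the Bergman kernel of a weight in `D`. -/
theorem Dclass.exists_integral_norm_kernel_le (hD : Dclass ν) (hν : RadialWeight ν)
    (hνp : WhatPos ν) :
    ∃ C > (0 : ℝ), ∀ s : ℝ, 0 ≤ s → s < 1 →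
      ∫ θ in -Real.pi..Real.pi, ‖∑' n, ((kernelCoeff ν n * s ^ n : ℝ) : ℂ) *
        Complex.exp (Complex.I * θ) ^ n‖ ≤ C / what ν s := by
  obtain ⟨D, hl⟩ := exists_slowlyGrowing_kernelCoeff hν hνp hD.1
  obtain ⟨A, hA, hAs⟩ := hl.exists_integral_norm_le
  obtain ⟨B, hB, hBs⟩ := hD.2.exists_sum_inv_what_le hν hνp
  obtain ⟨C, hC, hCr⟩ := hD.1
  refine ⟨A * (4 * (B * C)), by positivity, fun s hs hs1 => ?_⟩
  obtain ⟨J, hJ1, hJ2⟩ := exists_nat_pow_near_of_lt_one (x := 1 - s) (y := 1 / 2)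
    (by linarith) (by linarith) (by norm_num) (by norm_num)
  have hmem : ∀ j : ℕ, 0 ≤ 1 - (1 / 2 : ℝ) ^ j ∧ 1 - (1 / 2 : ℝ) ^ j < 1 := fun j =>
    ⟨by linarith [pow_le_one₀ (n := j) (by norm_num : (0 : ℝ) ≤ 1 / 2) (by norm_num)],
      by linarith [pow_pos (by norm_num : (0 : ℝ) < 1 / 2) j]⟩
  have hpos : ∀ j, 0 < what ν (1 - (1 / 2) ^ j) := fun j => hνp _ (hmem j).1 (hmem j).2
  refine (hAs s J hs hs1 (by rwa [one_div_pow] at hJ2) ?_).trans ?_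
  · rw [one_div_pow, pow_succ, mul_comm] at hJ1
    exact hJ1.le
  rw [mul_div_assoc]
  refine mul_le_mul_of_nonneg_left ?_ hA.le
  calc ∑ j ∈ Finset.range (J + 1), kernelCoeff ν (2 ^ j)
      ≤ ∑ j ∈ Finset.range (J + 1), 4 * (1 / what ν (1 - (1 / 2) ^ (j + 1))) :=
        Finset.sum_le_sum fun j _ => by
          rw [mul_one_div]
          exact kernelCoeff_two_pow_le hν hνp j
    _ = 4 * ∑ j ∈ Finset.range (J + 1), 1 / what ν (1 - (1 / 2) ^ (j + 1)) := by
        rw [Finset.mul_sum]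
    _ ≤ 4 * ∑ j ∈ Finset.range (J + 1 + 1), 1 / what ν (1 - (1 / 2) ^ j) := by
        rw [Finset.sum_range_succ' (fun j => 1 / what ν (1 - (1 / 2) ^ j))]
        have := hpos 0
        have h0 : 0 ≤ 1 / what ν (1 - (1 / 2) ^ 0) := by positivity
        linarith
    _ ≤ 4 * (B * (1 / what ν (1 - (1 / 2) ^ (J + 1)))) := by
        gcongr
        exact hBs (J + 1)
    _ ≤ 4 * (B * (C / what ν s)) := by
        have h1 : what ν s ≤ C * what ν (1 - (1 / 2) ^ (J + 1)) := by
          have h2 := hCr _ (hmem J).1 (hmem J).2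
          rw [show (1 + (1 - (1 / 2 : ℝ) ^ J)) / 2 = 1 - (1 / 2) ^ (J + 1) by
            rw [pow_succ]; ring] at h2
          exact (what_antitone hν hνp (hmem J).1 (by linarith) hs1.le).trans h2
        have h3 := hνp s hs hs1
        refine mul_le_mul_of_nonneg_left (mul_le_mul_of_nonneg_left ?_ hB.le) (by norm_num)
        rw [div_le_div_iff₀ (hpos _) h3]
        linarith
    _ = 4 * (B * C) / what ν s := by ring

end KernelMeans

section RadialIntegral

variable {ν : ℂ → ℝ}

theorem what_one : what ν 1 = 0 := intervalIntegral.integral_same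

theorem continuousOn_what (hνp : WhatPos ν) : ContinuousOn (what ν) (Icc 0 1) := by
  have h := intervalIntegral.continuousOn_primitive_interval_left (a := (0 : ℝ)) (b := 1)
    (f := fun s : ℝ => ν (s : ℂ)) (μ := volume) ?_
  · rwa [uIcc_of_le zero_le_one] at h
  · rw [uIcc_of_le zero_le_one]
    exact (intervalIntegrable_iff_integrableOn_Icc_of_le zero_le_one).1
      (RadialWeight.intervalIntegrable hνp)

theorem aemeasurable_what (hνp : WhatPos ν) : AEMeasurable (what ν) (radialMeasure ν) :=
  (((continuousOn_what hνp).mono Ioo_subset_Icc_self).aemeasurable measurableSet_Ioo).mono_ac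
    (withDensity_absolutelyContinuous _ _)

theorem radialMeasure_congr_of_Ioo {s t : Set ℝ} (h : ∀ r ∈ Ioo (0 : ℝ) 1, r ∈ s ↔ r ∈ t) :
    radialMeasure ν s = radialMeasure ν t :=
  measure_congr (radialMeasure_ae_mem.mono fun r hr => propext (h r hr))

/-- The tail function `ν̂` pushes the radial measure forward to Lebesgue measure. -/
theorem map_what_radialMeasure (hν : RadialWeight ν) (hνp : WhatPos ν) :
    (radialMeasure ν).map (what ν) = volume.restrict (Ioc 0 (what ν 0)) := by
  have hfin : IsFiniteMeasure (radialMeasure ν) := by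
    refine ⟨?_⟩
    rw [radialMeasure_congr_of_Ioo (t := Ici 0) fun r hr => by simp [hr.1.le],
      radialMeasure_Ici hν hνp le_rfl zero_le_one]
    exact ENNReal.ofReal_lt_top
  refine Measure.ext_of_Iic _ _ fun u => ?_
  rw [Measure.map_apply_of_aemeasurable (aemeasurable_what hνp) measurableSet_Iic,
    Measure.restrict_apply measurableSet_Iic]
  have hv : Iic u ∩ Ioc 0 (what ν 0) = Ioc 0 (min u (what ν 0)) := by
    ext x
    simp only [mem_inter_iff, mem_Iic, mem_Ioc, le_min_iff]
    tauto
  rw [hv, Real.volume_Ioc, sub_zero]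
  rcases lt_or_ge u 0 with hu | hu
  · rw [ENNReal.ofReal_of_nonpos ((min_le_left _ _).trans hu.le),
      radialMeasure_congr_of_Ioo (t := ∅) fun r hr => ?_, measure_empty]
    have := hνp r hr.1.le hr.2
    simp only [mem_preimage, mem_Iic, mem_empty_iff_false, iff_false, not_le]
    linarith
  have hcont := continuousOn_what hνp
  have hS : IsCompact (Icc (0 : ℝ) 1 ∩ what ν ⁻¹' Iic u) :=
    isCompact_Icc.of_isClosed_subset (hcont.preimage_isClosed_of_isClosed isClosed_Icc isClosed_Iic)
      inter_subset_left
  obtain ⟨a, ⟨haI, hau⟩, ha⟩ := hS.exists_isLeast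
    ⟨1, ⟨zero_le_one, le_rfl⟩, by simpa [what_one] using hu⟩
  rw [radialMeasure_congr_of_Ioo (t := Ici a) fun r hr => ?_, radialMeasure_Ici hν hνp haI.1 haI.2]
  · congr 1
    refine le_antisymm (le_min hau (what_antitone hν hνp le_rfl haI.1 haI.2)) ?_
    have h0 : (0 : ℝ) ∈ Icc (0 : ℝ) 1 := ⟨le_rfl, zero_le_one⟩
    obtain ⟨b, hb, hbe⟩ := intermediate_value_Icc' haI.1
      (hcont.mono (Icc_subset_Icc_right haI.2))
      (⟨le_min hau (what_antitone hν hνp le_rfl haI.1 haI.2), min_le_right _ _⟩ :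
        min u (what ν 0) ∈ Icc (what ν a) (what ν 0))
    have hba : a ≤ b := ha ⟨⟨hb.1, hb.2.trans haI.2⟩, hbe.le.trans (min_le_left _ _)⟩
    rw [← hbe, le_antisymm hb.2 hba]
  · exact ⟨fun h => ha ⟨⟨hr.1.le, hr.2.le⟩, h⟩,
      fun h => (what_antitone hν hνp haI.1 h hr.2.le).trans hau⟩

theorem lintegral_Ioc_rpow_neg {ε w : ℝ} (hε1 : ε < 1) (hw : 0 ≤ w) :
    ∫⁻ u in Ioc 0 w, ENNReal.ofReal (u ^ (-ε)) = ENNReal.ofReal (w ^ (1 - ε) / (1 - ε)) := by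
  have hi : IntervalIntegrable (fun u : ℝ => u ^ (-ε)) volume 0 w :=
    intervalIntegral.intervalIntegrable_rpow' (by linarith)
  rw [← ofReal_integral_eq_lintegral_ofReal ((intervalIntegrable_iff_integrableOn_Ioc_of_le hw).1 hi),
    ← intervalIntegral.integral_of_le hw, integral_rpow (Or.inl (by linarith)),
    Real.zero_rpow (by linarith), sub_zero, neg_add_eq_sub]
  filter_upwards [ae_restrict_mem measurableSet_Ioc] with u hu
  exact Real.rpow_nonneg hu.1.le _

theorem lintegral_Ioi_rpow_neg {ε w : ℝ} (hε : 0 < ε) (hw : 0 < w) :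
    ∫⁻ u in Ioi w, ENNReal.ofReal (u ^ (-ε - 1)) = ENNReal.ofReal (w ^ (-ε) / ε) := by
  rw [← ofReal_integral_eq_lintegral_ofReal (integrableOn_Ioi_rpow_of_lt (by linarith) hw),
    integral_Ioi_rpow_of_lt (by linarith) hw, sub_add_cancel, neg_div_neg_eq]
  filter_upwards [ae_restrict_mem measurableSet_Ioi] with u hu
  exact Real.rpow_nonneg (hw.trans hu).le _

theorem lintegral_what_rpow_neg_mul_le (hν : RadialWeight ν) (hνp : WhatPos ν) {ε ρ : ℝ}
    (hε : 0 < ε) (hε1 : ε < 1) (hρ : 0 ≤ ρ) (hρ1 : ρ < 1) :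
    ∫⁻ r, ENNReal.ofReal (what ν r ^ (-ε)) * ENNReal.ofReal (1 / what ν (r * ρ))
        ∂(radialMeasure ν)
      ≤ ENNReal.ofReal ((1 / (1 - ε) + 1 / ε) * what ν ρ ^ (-ε)) := by
  set w := what ν ρ with hw
  have hw0 : 0 < w := hνp ρ hρ hρ1
  set F : ℝ → ℝ≥0∞ := fun u => ENNReal.ofReal (u ^ (-ε)) * ENNReal.ofReal (min (1 / u) (1 / w))
    with hF
  have hFm : Measurable F := by
    simp only [hF]
    fun_prop
  calc _ ≤ ∫⁻ r, F (what ν r) ∂(radialMeasure ν) := by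
        refine lintegral_mono_ae (radialMeasure_ae_mem.mono fun r hr => ?_)
        refine mul_le_mul' le_rfl (ENNReal.ofReal_le_ofReal (le_min ?_ ?_))
        · exact one_div_le_one_div_of_le (hνp r hr.1.le hr.2)
            (what_antitone hν hνp (mul_nonneg hr.1.le hρ) (mul_le_of_le_one_right hr.1.le hρ1.le)
              hr.2.le)
        · exact one_div_le_one_div_of_le hw0
            (what_antitone hν hνp (mul_nonneg hr.1.le hρ) (mul_le_of_le_one_left hρ hr.2.le)
              hρ1.le)
    _ = ∫⁻ u in Ioc 0 (what ν 0), F u := by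
        rw [← map_what_radialMeasure hν hνp,
          lintegral_map' hFm.aemeasurable (aemeasurable_what hνp)]
    _ ≤ ∫⁻ u in Ioc 0 w ∪ Ioi w, F u :=
        lintegral_mono_set fun u hu => (le_or_gt u w).imp (fun h => ⟨hu.1, h⟩) id
    _ ≤ (∫⁻ u in Ioc 0 w, F u) + ∫⁻ u in Ioi w, F u := lintegral_union_le _ _ _
    _ ≤ (∫⁻ u in Ioc 0 w, ENNReal.ofReal (1 / w) * ENNReal.ofReal (u ^ (-ε))) +
          ∫⁻ u in Ioi w, ENNReal.ofReal (u ^ (-ε - 1)) := by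
        refine add_le_add (setLIntegral_mono' measurableSet_Ioc fun u hu => ?_)
          (setLIntegral_mono' measurableSet_Ioi fun u hu => ?_)
        · rw [mul_comm (ENNReal.ofReal (1 / w))]
          exact mul_le_mul' le_rfl (ENNReal.ofReal_le_ofReal (min_le_right _ _))
        · have hu0 : 0 < u := hw0.trans hu
          rw [Real.rpow_sub_one hu0.ne', div_eq_mul_one_div,
            ENNReal.ofReal_mul (Real.rpow_nonneg hu0.le _)]
          exact mul_le_mul' le_rfl (ENNReal.ofReal_le_ofReal (min_le_left _ _))
    _ = ENNReal.ofReal ((1 / (1 - ε) + 1 / ε) * w ^ (-ε)) := by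
        have h1 : 0 < 1 - ε := by linarith
        rw [lintegral_const_mul' _ _ ENNReal.ofReal_ne_top, lintegral_Ioc_rpow_neg hε1 hw0.le,
          lintegral_Ioi_rpow_neg hε hw0, ← ENNReal.ofReal_mul (by positivity),
          ← ENNReal.ofReal_add (by positivity) (by positivity)]
        congr 1
        rw [sub_eq_add_neg 1 ε, Real.rpow_add hw0, Real.rpow_one]
        field_simp

end RadialIntegral

section SchurBound

variable {ν : ℂ → ℝ}

theorem norm_Bker_polar (ν : ℂ → ℝ) (z : ℂ) (r θ : ℝ) :
    ‖Bker ν z (r * Complex.exp (Complex.I * θ))‖ =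
      ‖∑' n, ((kernelCoeff ν n * (r * ‖z‖) ^ n : ℝ) : ℂ) *
        Complex.exp (Complex.I * (θ - z.arg : ℝ)) ^ n‖ := by
  have hz : conj z = ‖z‖ * Complex.exp (Complex.I * (-z.arg : ℝ)) := by
    conv_lhs => rw [← Complex.norm_mul_exp_arg_mul_I z]
    rw [map_mul, Complex.conj_ofReal, ← Complex.exp_conj, map_mul, Complex.conj_ofReal,
      Complex.conj_I]
    push_cast
    ring_nf
  have he : Complex.exp (Complex.I * (θ - z.arg : ℝ)) =
      Complex.exp (Complex.I * θ) * Complex.exp (Complex.I * (-z.arg : ℝ)) := by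
    rw [← Complex.exp_add]
    push_cast
    ring_nf
  rw [Bker]
  congr 1
  refine tsum_congr fun n => ?_
  rw [hz, he, kernelCoeff]
  push_cast
  ring

theorem norm_Bker_comm (ν : ℂ → ℝ) (z ζ : ℂ) : ‖Bker ν z ζ‖ = ‖Bker ν ζ z‖ := by
  rw [← RCLike.norm_conj, Bker, Bker, Complex.conj_tsum]
  congr 1
  refine tsum_congr fun n => ?_
  rw [map_div₀, map_pow, map_mul, Complex.conj_conj, Complex.conj_ofReal, mul_comm]

theorem Dclass.exists_lintegral_enorm_Bker_le (hD : Dclass ν) (hν : RadialWeight ν)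
    (hνp : WhatPos ν) :
    ∃ C > (0 : ℝ), ∀ z : ℂ, ‖z‖ < 1 → ∀ r : ℝ, 0 ≤ r → r < 1 →
      ∫⁻ θ in Ioo (-Real.pi) Real.pi, ‖Bker ν z (r * Complex.exp (Complex.I * θ))‖ₑ
        ≤ ENNReal.ofReal C * ENNReal.ofReal (1 / what ν (r * ‖z‖)) := by
  obtain ⟨C, hC, hCs⟩ := hD.exists_integral_norm_kernel_le hν hνp
  obtain ⟨D, hl⟩ := exists_slowlyGrowing_kernelCoeff hν hνp hD.1
  refine ⟨C, hC, fun z hz r hr hr1 => ?_⟩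
  set s := r * ‖z‖ with hs
  have hs0 : 0 ≤ s := by positivity
  have hs1 : s < 1 := mul_lt_one_of_nonneg_of_lt_one_left hr hr1 hz.le
  set G : ℝ → ℝ := fun θ => ‖∑' n, ((kernelCoeff ν n * s ^ n : ℝ) : ℂ) *
    Complex.exp (Complex.I * θ) ^ n‖ with hG
  have hGc : Continuous G := by
    refine (continuous_tsum_exp ?_).norm
    refine (hl.summable_mul_pow hs0 hs1).congr fun n => ?_
    rw [Complex.norm_real, Real.norm_of_nonneg (mul_nonneg (hl.pos n).le (pow_nonneg hs0 n))]
  have hGp : Function.Periodic G (2 * Real.pi) := by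
    intro θ
    have : Complex.exp (Complex.I * (θ + 2 * Real.pi : ℝ)) = Complex.exp (Complex.I * θ) := by
      rw [← Complex.exp_periodic (Complex.I * θ)]
      push_cast
      ring_nf
    simp only [hG, this]
  have hint : ∫ θ in -Real.pi..Real.pi, G (θ - z.arg) ≤ C / what ν s := by
    have hp := hGp.intervalIntegral_add_eq (-Real.pi - z.arg) (-Real.pi)
    rw [show -Real.pi - z.arg + 2 * Real.pi = Real.pi - z.arg by ring,
      show -Real.pi + 2 * Real.pi = Real.pi by ring] at hp
    rw [intervalIntegral.integral_comp_sub_right, hp]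
    exact hCs s hs0 hs1
  have hcs : Continuous fun θ => G (θ - z.arg) := hGc.comp (continuous_id.sub continuous_const)
  have hle : -Real.pi ≤ Real.pi := by linarith [Real.pi_pos]
  calc _ = ∫⁻ θ in Ioo (-Real.pi) Real.pi, ENNReal.ofReal (G (θ - z.arg)) := by
        refine lintegral_congr fun θ => ?_
        rw [← ofReal_norm, norm_Bker_polar]
    _ = ENNReal.ofReal (∫ θ in -Real.pi..Real.pi, G (θ - z.arg)) := by
        rw [intervalIntegral.integral_of_le hle, integral_Ioc_eq_integral_Ioo,
          ofReal_integral_eq_lintegral_ofReal]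
        · exact (intervalIntegrable_iff_integrableOn_Ioo_of_le hle).1 (hcs.intervalIntegrable _ _)
        · exact ae_of_all _ fun θ => norm_nonneg _
    _ ≤ _ := by
        rw [← ENNReal.ofReal_mul hC.le, mul_one_div]
        exact ENNReal.ofReal_le_ofReal hint

/-- The measure `ν dA` on the disc. -/
noncomputable def discMeasure (ν : ℂ → ℝ) : Measure ℂ :=
  (dA.restrict UD).withDensity fun z => ENNReal.ofReal (ν z)

theorem aemeasurable_weight (hν : RadialWeight ν) :
    AEMeasurable (fun z => ENNReal.ofReal (ν z)) (dA.restrict UD) :=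
  hν.2.2.aestronglyMeasurable.aemeasurable.ennreal_ofReal

theorem lintegral_discMeasure (hν : RadialWeight ν) (f : ℂ → ℝ≥0∞) :
    ∫⁻ z, f z ∂(discMeasure ν) = ∫⁻ z in UD, ENNReal.ofReal (ν z) * f z ∂dA := by
  rw [discMeasure, lintegral_withDensity_eq_lintegral_mul_non_measurable₀ _
    (aemeasurable_weight hν) (ae_of_all _ fun _ => ENNReal.ofReal_lt_top)]
  rfl

theorem discMeasure_ae_mem : ∀ᵐ z ∂(discMeasure ν), z ∈ UD :=
  (withDensity_absolutelyContinuous _ _).ae_le (ae_restrict_mem measurableSet_ball)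

/-- The Schur test function estimate for the Bergman kernel. -/
theorem Dclass.exists_schur_bound (hD : Dclass ν) (hν : RadialWeight ν) (hνp : WhatPos ν)
    {ε : ℝ} (hε : 0 < ε) (hε1 : ε < 1) :
    ∃ C > (0 : ℝ), ∀ z ∈ UD,
      ∫⁻ ζ, ‖Bker ν z ζ‖ₑ * ENNReal.ofReal (what ν ‖ζ‖ ^ (-ε)) ∂(discMeasure ν)
        ≤ ENNReal.ofReal C * ENNReal.ofReal (what ν ‖z‖ ^ (-ε)) := by
  obtain ⟨C, hC, hCk⟩ := hD.exists_lintegral_enorm_Bker_le hν hνp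
  have hε2 : 0 < 1 - ε := by linarith
  have hπ := Real.pi_pos
  refine ⟨Real.pi⁻¹ * (C * (1 / (1 - ε) + 1 / ε)), by positivity, fun z hz => ?_⟩
  have hz1 : ‖z‖ < 1 := mem_ball_zero_iff.1 hz
  set H : ℂ → ℝ≥0∞ := fun ζ =>
    ENNReal.ofReal (ν ζ) * (‖Bker ν z ζ‖ₑ * ENNReal.ofReal (what ν ‖ζ‖ ^ (-ε))) with hH
  set R : ℝ → ℝ≥0∞ := fun r => ENNReal.ofReal (ν r) *
    (ENNReal.ofReal (what ν r ^ (-ε)) * ENNReal.ofReal (1 / what ν (r * ‖z‖))) with hR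
  have hrad : ∀ r ∈ Ioi (0 : ℝ), ∫⁻ θ in Ioo (-Real.pi) Real.pi, ENNReal.ofReal r *
      UD.indicator H (r * Complex.exp (Complex.I * θ))
        ≤ (Ioo (0 : ℝ) 1).indicator (fun r => ENNReal.ofReal C * R r) r := by
    intro r hr
    have hr0 : 0 < r := hr
    have hnorm : ∀ θ : ℝ, ‖(r : ℂ) * Complex.exp (Complex.I * θ)‖ = r := fun θ => by
      rw [norm_mul, mul_comm Complex.I, Complex.norm_exp_ofReal_mul_I, mul_one, Complex.norm_real,
        Real.norm_of_nonneg hr0.le]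
    rcases lt_or_ge r 1 with hr1 | hr1
    · rw [indicator_of_mem (show r ∈ Ioo (0 : ℝ) 1 from ⟨hr0, hr1⟩)]
      calc _ ≤ ∫⁻ θ in Ioo (-Real.pi) Real.pi, (ENNReal.ofReal (ν r) *
              ENNReal.ofReal (what ν r ^ (-ε))) *
                ‖Bker ν z (r * Complex.exp (Complex.I * θ))‖ₑ := by
            refine lintegral_mono fun θ => ?_
            have hmem : (r : ℂ) * Complex.exp (Complex.I * θ) ∈ UD :=
              mem_ball_zero_iff.2 (by rwa [hnorm])
            simp only [indicator_of_mem hmem, hH]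
            rw [hν.2.1 (r * Complex.exp (Complex.I * θ)), hnorm]
            refine (mul_le_mul' (ENNReal.ofReal_le_one.2 hr1.le) le_rfl).trans_eq ?_
            ring
        _ = (ENNReal.ofReal (ν r) * ENNReal.ofReal (what ν r ^ (-ε))) *
              ∫⁻ θ in Ioo (-Real.pi) Real.pi, ‖Bker ν z (r * Complex.exp (Complex.I * θ))‖ₑ :=
            lintegral_const_mul' _ _
              (ENNReal.mul_ne_top ENNReal.ofReal_ne_top ENNReal.ofReal_ne_top)
        _ ≤ (ENNReal.ofReal (ν r) * ENNReal.ofReal (what ν r ^ (-ε))) *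
              (ENNReal.ofReal C * ENNReal.ofReal (1 / what ν (r * ‖z‖))) := by
            gcongr
            exact hCk z hz1 r hr0.le hr1
        _ = _ := by
            simp only [hR]
            ring
    · have : ∀ θ : ℝ, (r : ℂ) * Complex.exp (Complex.I * θ) ∉ UD := fun θ h => by
        have := mem_ball_zero_iff.1 h
        rw [hnorm] at this
        linarith
      simp [this]
  have hvol : ∫⁻ ζ in UD, H ζ ≤ ENNReal.ofReal C * ENNReal.ofReal
      ((1 / (1 - ε) + 1 / ε) * what ν ‖z‖ ^ (-ε)) := by
    calc ∫⁻ ζ in UD, H ζ = ∫⁻ ζ, UD.indicator H ζ := (lintegral_indicator measurableSet_ball _).symm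
      _ = ∫⁻ p in Ioi (0 : ℝ) ×ˢ Ioo (-Real.pi) Real.pi, ENNReal.ofReal p.1 *
            UD.indicator H (p.1 * Complex.exp (Complex.I * p.2)) := by
          rw [← Complex.lintegral_comp_polarCoord_symm]
          refine lintegral_congr fun p => ?_
          rw [Complex.polarCoord_symm_apply, mul_comm Complex.I, Complex.exp_mul_I]
          simp
      _ ≤ ∫⁻ r in Ioi (0 : ℝ), ∫⁻ θ in Ioo (-Real.pi) Real.pi, ENNReal.ofReal r *
            UD.indicator H (r * Complex.exp (Complex.I * θ)) := by
          rw [Measure.volume_eq_prod, ← Measure.prod_restrict]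
          exact lintegral_prod_le _
      _ ≤ ∫⁻ r in Ioi (0 : ℝ), (Ioo (0 : ℝ) 1).indicator (fun r => ENNReal.ofReal C * R r) r :=
          setLIntegral_mono' measurableSet_Ioi hrad
      _ = ∫⁻ r in Ioo (0 : ℝ) 1, ENNReal.ofReal C * R r := by
          rw [setLIntegral_indicator measurableSet_Ioo, inter_eq_left.2 Ioo_subset_Ioi_self]
      _ = ENNReal.ofReal C * ∫⁻ r, ENNReal.ofReal (what ν r ^ (-ε)) *
            ENNReal.ofReal (1 / what ν (r * ‖z‖)) ∂(radialMeasure ν) := by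
          rw [lintegral_const_mul' _ _ ENNReal.ofReal_ne_top, radialMeasure,
            lintegral_withDensity_eq_lintegral_mul_non_measurable₀ _ (aemeasurable_radial hνp)
              (ae_of_all _ fun _ => ENNReal.ofReal_lt_top)]
          rfl
      _ ≤ _ := by
          gcongr
          exact lintegral_what_rpow_neg_mul_le hν hνp hε hε1 (norm_nonneg z) hz1
  have hw : 0 ≤ what ν ‖z‖ ^ (-ε) := Real.rpow_nonneg (hνp _ (norm_nonneg z) hz1).le _
  calc _ = (ENNReal.ofReal Real.pi)⁻¹ * ∫⁻ ζ in UD, H ζ := by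
        rw [lintegral_discMeasure hν, dA, Measure.restrict_smul, lintegral_smul_measure,
          smul_eq_mul]
    _ ≤ (ENNReal.ofReal Real.pi)⁻¹ * (ENNReal.ofReal C * ENNReal.ofReal
      ((1 / (1 - ε) + 1 / ε) * what ν ‖z‖ ^ (-ε))) := by gcongr
    _ = _ := by
        rw [← ENNReal.ofReal_inv_of_pos hπ, ← ENNReal.ofReal_mul hC.le,
          ← ENNReal.ofReal_mul (by positivity), ← ENNReal.ofReal_mul (by positivity)]
        congr 1
        ring

end SchurBound

section SchurTest

/-- Schur's test for nonnegative kernels. -/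
theorem lintegral_rpow_lintegral_mul_le_of_schur {α : Type*} [MeasurableSpace α] {μ : Measure α}
    [SFinite μ] {p q : ℝ} (hpq : p.HolderConjugate q) {K : α → α → ℝ≥0∞} {h f : α → ℝ≥0∞}
    {A : ℝ≥0∞} (hK : AEMeasurable (Function.uncurry K) (μ.prod μ)) (hh : AEMeasurable h μ)
    (hf : AEMeasurable f μ) (h0 : ∀ᵐ x ∂μ, h x ≠ 0) (htop : ∀ᵐ x ∂μ, h x ≠ ∞)
    (h1 : ∀ᵐ x ∂μ, ∫⁻ y, K x y * h y ^ p ∂μ ≤ A * h x ^ p)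
    (h2 : ∀ᵐ y ∂μ, ∫⁻ x, K x y * h x ^ q ∂μ ≤ A * h y ^ q) :
    ∫⁻ x, (∫⁻ y, K x y * f y ∂μ) ^ q ∂μ ≤ A ^ q * ∫⁻ y, f y ^ q ∂μ := by
  have hp0 := hpq.pos
  have hq0 := hpq.symm.pos
  have hpq1 : p⁻¹ + q⁻¹ = 1 := hpq.inv_add_inv_eq_one
  have hexp : 1 / p * q + 1 = q := by
    have : q * q⁻¹ = 1 := mul_inv_cancel₀ hq0.ne'
    rw [one_div]
    linear_combination q * hpq1 - this
  have hKx : ∀ᵐ x ∂μ, AEMeasurable (K x) μ :=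
    hK.aestronglyMeasurable.prodMk_left.mono fun x hx => hx.aemeasurable
  set g : α → ℝ≥0∞ := fun y => f y ^ q * (h y ^ q)⁻¹ with hg
  have hgm : AEMeasurable g μ := (hf.pow_const q).mul (hh.pow_const q).inv
  have hpt : ∀ᵐ x ∂μ, (∫⁻ y, K x y * f y ∂μ) ^ q
      ≤ A ^ (1 / p * q) * ∫⁻ y, h x ^ q * (K x y * g y) ∂μ := by
    filter_upwards [hKx, h1] with x hKm hx
    have hu : AEMeasurable (fun y => K x y ^ (1 / p) * h y) μ := (hKm.pow_const _).mul hh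
    have hv : AEMeasurable (fun y => K x y ^ (1 / q) * (f y * (h y)⁻¹)) μ :=
      (hKm.pow_const _).mul (hf.mul hh.inv)
    have hcs := ENNReal.lintegral_mul_le_Lp_mul_Lq μ hpq hu hv
    have e0 : ∫⁻ y, K x y * f y ∂μ = ∫⁻ y, ((fun y => K x y ^ (1 / p) * h y) *
        fun y => K x y ^ (1 / q) * (f y * (h y)⁻¹)) y ∂μ := by
      refine lintegral_congr_ae ?_
      filter_upwards [h0, htop] with y hy0 hyt
      simp only [Pi.mul_apply]
      calc K x y * f y = K x y ^ (1 / p + 1 / q) * f y := by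
            rw [one_div, one_div, hpq1, ENNReal.rpow_one]
        _ = K x y ^ (1 / p) * K x y ^ (1 / q) * (h y * (h y)⁻¹) * f y := by
            rw [ENNReal.rpow_add_of_nonneg _ _ (by positivity) (by positivity),
              ENNReal.mul_inv_cancel hy0 hyt, mul_one]
        _ = _ := by ring
    have e1 : ∀ y, (K x y ^ (1 / p) * h y) ^ p = K x y * h y ^ p := fun y => by
      rw [ENNReal.mul_rpow_of_nonneg _ _ hp0.le, ← ENNReal.rpow_mul, one_div_mul_cancel hp0.ne',
        ENNReal.rpow_one]
    have e2 : ∀ y, (K x y ^ (1 / q) * (f y * (h y)⁻¹)) ^ q = K x y * g y := fun y => by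
      rw [ENNReal.mul_rpow_of_nonneg _ _ hq0.le, ENNReal.mul_rpow_of_nonneg _ _ hq0.le,
        ← ENNReal.rpow_mul, one_div_mul_cancel hq0.ne', ENNReal.rpow_one, ENNReal.inv_rpow]
    simp only [e1, e2] at hcs
    calc (∫⁻ y, K x y * f y ∂μ) ^ q
        ≤ ((A * h x ^ p) ^ (1 / p) * (∫⁻ y, K x y * g y ∂μ) ^ (1 / q)) ^ q := by
          rw [e0]
          gcongr
          refine hcs.trans ?_
          gcongr
      _ = A ^ (1 / p * q) * (h x ^ q * ∫⁻ y, K x y * g y ∂μ) := by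
          rw [ENNReal.mul_rpow_of_nonneg _ _ hq0.le, ← ENNReal.rpow_mul _ (1 / q),
            one_div_mul_cancel hq0.ne', ENNReal.rpow_one, ← ENNReal.rpow_mul,
            ENNReal.mul_rpow_of_nonneg _ _ (by positivity), ← ENNReal.rpow_mul, ← mul_assoc p,
            mul_one_div_cancel hp0.ne', one_mul, mul_assoc]
      _ = _ := by
          rw [lintegral_const_mul'' (f := fun y => K x y * g y) _ (hKm.mul hgm)]
  have hsw : ∫⁻ x, ∫⁻ y, h x ^ q * (K x y * g y) ∂μ ∂μ
      = ∫⁻ y, ∫⁻ x, h x ^ q * (K x y * g y) ∂μ ∂μ := by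
    refine lintegral_lintegral_swap ?_
    exact (hh.pow_const q).comp_fst.mul (hK.mul hgm.comp_snd)
  have hKy : ∀ᵐ y ∂μ, AEMeasurable (fun x => K x y) μ :=
    hK.aestronglyMeasurable.prod_swap.prodMk_left.mono fun x hx => hx.aemeasurable
  calc ∫⁻ x, (∫⁻ y, K x y * f y ∂μ) ^ q ∂μ
      ≤ ∫⁻ x, A ^ (1 / p * q) * ∫⁻ y, h x ^ q * (K x y * g y) ∂μ ∂μ := lintegral_mono_ae hpt
    _ = A ^ (1 / p * q) * ∫⁻ x, ∫⁻ y, h x ^ q * (K x y * g y) ∂μ ∂μ := by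
        refine lintegral_const_mul'' _ ?_
        exact ((hh.pow_const q).comp_fst.mul (hK.mul hgm.comp_snd)).lintegral_prod_right'
    _ = A ^ (1 / p * q) * ∫⁻ y, ∫⁻ x, h x ^ q * (K x y * g y) ∂μ ∂μ := by rw [hsw]
    _ ≤ A ^ (1 / p * q) * ∫⁻ y, A * f y ^ q ∂μ := by
        refine mul_le_mul' le_rfl (lintegral_mono_ae ?_)
        filter_upwards [h2, hKy, h0, htop] with y hy hKm hy0 hyt
        calc ∫⁻ x, h x ^ q * (K x y * g y) ∂μ = ∫⁻ x, g y * (K x y * h x ^ q) ∂μ :=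
              lintegral_congr fun x => by ring
          _ = g y * ∫⁻ x, K x y * h x ^ q ∂μ :=
              lintegral_const_mul'' _ (hKm.mul (hh.pow_const q))
          _ ≤ g y * (A * h y ^ q) := by gcongr
          _ = A * f y ^ q * (h y ^ q * (h y ^ q)⁻¹) := by
              simp only [hg]
              ring
          _ = A * f y ^ q := by
              rw [ENNReal.mul_inv_cancel, mul_one]
              · simp [ENNReal.rpow_eq_zero_iff, hy0, hyt]
              · simp [ENNReal.rpow_eq_top_iff, hy0, hyt]
    _ = A ^ q * ∫⁻ y, f y ^ q ∂μ := by
        rw [lintegral_const_mul'' _ (hf.pow_const q), ← mul_assoc]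
        congr 1
        nth_rewrite 2 [← ENNReal.rpow_one A]
        rw [← ENNReal.rpow_add_of_nonneg _ _ (by positivity) zero_le_one, hexp]

end SchurTest

section MaximalProjection

variable {ν : ℂ → ℝ}

instance : SFinite dA := by
  unfold dA
  infer_instance

instance : SFinite (discMeasure ν) := by
  unfold discMeasure
  infer_instance

theorem aemeasurable_Bker (hν : RadialWeight ν) (hνp : WhatPos ν) (hD : Dhat ν) :
    AEMeasurable (Function.uncurry (Bker ν)) ((discMeasure ν).prod (discMeasure ν)) := by
  obtain ⟨D, hl⟩ := exists_slowlyGrowing_kernelCoeff hν hνp hD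
  refine aemeasurable_of_tendsto_metrizable_ae Filter.atTop
    (f := fun (N : ℕ) (x : ℂ × ℂ) => ∑ n ∈ Finset.range N,
      (x.2 * conj x.1) ^ n / (((2 * mom ν (2 * (n : ℝ) + 1) : ℝ)) : ℂ)) (fun N => ?_) ?_
  · refine Continuous.aemeasurable ?_
    fun_prop
  · filter_upwards [Measure.quasiMeasurePreserving_fst.ae discMeasure_ae_mem,
      Measure.quasiMeasurePreserving_snd.ae discMeasure_ae_mem] with x h1 h2
    have h1' : ‖x.1‖ < 1 := mem_ball_zero_iff.1 h1
    have h2' : ‖x.2‖ < 1 := mem_ball_zero_iff.1 h2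
    refine (Summable.of_norm ?_).hasSum.tendsto_sum_nat
    refine (hl.summable_mul_pow (s := ‖x.2‖ * ‖x.1‖) (by positivity)
      (mul_lt_one_of_nonneg_of_lt_one_left (norm_nonneg _) h2' h1'.le)).congr fun n => ?_
    have hm := mom_pos hν hνp (x := 2 * (n : ℝ) + 1) (by positivity)
    rw [norm_div, norm_pow, norm_mul, RCLike.norm_conj, Complex.norm_real,
      Real.norm_of_nonneg (by positivity), kernelCoeff]
    ring

theorem aemeasurable_what_norm (hνp : WhatPos ν) :
    AEMeasurable (fun z : ℂ => what ν ‖z‖) (discMeasure ν) := by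
  have : ContinuousOn (fun z : ℂ => what ν ‖z‖) UD :=
    (continuousOn_what hνp).comp continuous_norm.continuousOn fun z hz =>
      ⟨norm_nonneg z, (mem_ball_zero_iff.1 hz).le⟩
  exact (this.aemeasurable measurableSet_ball).mono_ac
    (withDensity_absolutelyContinuous _ _)

/-- The maximal projection of a weight in `D` satisfies a strong-type estimate. -/
theorem Dclass.exists_lintegral_maximal_le (hD : Dclass ν) (hν : RadialWeight ν)
    (hνp : WhatPos ν) {q : ℝ} (hq : 1 < q) :
    ∃ C > (0 : ℝ), ∀ f : ℂ → ℝ≥0∞, AEMeasurable f (discMeasure ν) →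
      ∫⁻ z, (∫⁻ ζ, ‖Bker ν z ζ‖ₑ * f ζ ∂(discMeasure ν)) ^ q ∂(discMeasure ν)
        ≤ ENNReal.ofReal C ^ q * ∫⁻ ζ, f ζ ^ q ∂(discMeasure ν) := by
  set p := q.conjExponent with hp
  have hpq : p.HolderConjugate q := (Real.HolderConjugate.conjExponent hq).symm
  have hp0 := hpq.pos
  have hq0 := hpq.symm.pos
  obtain ⟨A, hA, hAs⟩ := hD.exists_schur_bound hν hνp (ε := q⁻¹) (by positivity)
    (inv_lt_one_of_one_lt₀ hq)
  obtain ⟨B, hB, hBs⟩ := hD.exists_schur_bound hν hνp (ε := p⁻¹) (by positivity)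
    (inv_lt_one_of_one_lt₀ hpq.lt)
  refine ⟨max A B, lt_max_of_lt_left hA, fun f hf => ?_⟩
  set h : ℂ → ℝ≥0∞ := fun z => ENNReal.ofReal (what ν ‖z‖ ^ (-(p⁻¹ * q⁻¹))) with hh
  have hw : ∀ z ∈ UD, 0 < what ν ‖z‖ := fun z hz =>
    hνp _ (norm_nonneg z) (mem_ball_zero_iff.1 hz)
  have hhp : ∀ z ∈ UD, h z ^ p = ENNReal.ofReal (what ν ‖z‖ ^ (-q⁻¹)) := fun z hz => by
    rw [hh, ENNReal.ofReal_rpow_of_pos (Real.rpow_pos_of_pos (hw z hz) _),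
      ← Real.rpow_mul (hw z hz).le]
    congr 2
    field_simp
  have hhq : ∀ z ∈ UD, h z ^ q = ENNReal.ofReal (what ν ‖z‖ ^ (-p⁻¹)) := fun z hz => by
    rw [hh, ENNReal.ofReal_rpow_of_pos (Real.rpow_pos_of_pos (hw z hz) _),
      ← Real.rpow_mul (hw z hz).le]
    congr 2
    field_simp
  refine lintegral_rpow_lintegral_mul_le_of_schur hpq (h := h)
    (aemeasurable_Bker hν hνp hD.1).enorm
    ((aemeasurable_what_norm hνp).pow_const _).ennreal_ofReal hf ?_
    (ae_of_all _ fun _ => ENNReal.ofReal_ne_top) ?_ ?_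
  · filter_upwards [discMeasure_ae_mem] with z hz
    exact (ENNReal.ofReal_pos.2 (Real.rpow_pos_of_pos (hw z hz) _)).ne'
  · filter_upwards [discMeasure_ae_mem] with z hz
    calc _ = ∫⁻ ζ, ‖Bker ν z ζ‖ₑ * ENNReal.ofReal (what ν ‖ζ‖ ^ (-q⁻¹)) ∂(discMeasure ν) :=
          lintegral_congr_ae (discMeasure_ae_mem.mono fun ζ hζ => by simp only [hhp ζ hζ])
      _ ≤ _ := hAs z hz
      _ ≤ _ := by
          rw [hhp z hz]
          gcongr
          exact le_max_left _ _
  · filter_upwards [discMeasure_ae_mem] with z hz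
    calc _ = ∫⁻ ζ, ‖Bker ν z ζ‖ₑ * ENNReal.ofReal (what ν ‖ζ‖ ^ (-p⁻¹)) ∂(discMeasure ν) :=
          lintegral_congr_ae (discMeasure_ae_mem.mono fun ζ hζ => by
            simp only [hhq ζ hζ]
            rw [← ofReal_norm, norm_Bker_comm, ofReal_norm])
      _ ≤ _ := hBs z hz
      _ ≤ _ := by
          rw [hhq z hz]
          gcongr
          exact le_max_right _ _

end MaximalProjection

/-- Proposition 2.6, second part: if `ν ∈ D`, the maximal Bergman projection
`P⁺_ν` is bounded on `L^q_ν` for `1<q<∞`. -/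
theorem maximal_projection_bounded (q : ℝ) (hq : 1 < q)
    (ν : ℂ → ℝ) (hν : RadialWeight ν) (hνp : WhatPos ν) (hνD : Dclass ν) :
    ∃ C > (0 : ℝ), ∀ f : ℂ → ℂ, MemLw q ν f →
      (∫ z in UD, |∫ ζ in UD, ‖f ζ‖ * ‖Bker ν z ζ‖ * ν ζ ∂dA| ^ q * ν z ∂dA) ^ (1 / q)
        ≤ C * wnorm q ν f := by
  have hq0 : 0 < q := by linarith
  obtain ⟨C, hC, hCf⟩ := hνD.exists_lintegral_maximal_le hν hνp hq
  refine ⟨C, hC, fun f ⟨hfm, hfi⟩ => ?_⟩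
  have hY : 0 ≤ ∫ z in UD, ‖f z‖ ^ q * ν z ∂dA :=
    integral_nonneg fun z => mul_nonneg (Real.rpow_nonneg (norm_nonneg _) _) (hν.1 z)
  have hX : 0 ≤ ∫ z in UD, |∫ ζ in UD, ‖f ζ‖ * ‖Bker ν z ζ‖ * ν ζ ∂dA| ^ q * ν z ∂dA :=
    integral_nonneg fun z => mul_nonneg (Real.rpow_nonneg (abs_nonneg _) _) (hν.1 z)
  have hinner : ∀ z, ‖∫ ζ in UD, ‖f ζ‖ * ‖Bker ν z ζ‖ * ν ζ ∂dA‖ₑ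
      ≤ ∫⁻ ζ, ‖Bker ν z ζ‖ₑ * ‖f ζ‖ₑ ∂(discMeasure ν) := fun z => by
    rw [lintegral_discMeasure hν]
    refine (enorm_integral_le_lintegral_enorm _).trans_eq (lintegral_congr fun ζ => ?_)
    rw [enorm_mul, enorm_mul, enorm_norm, enorm_norm, Real.enorm_of_nonneg (hν.1 ζ)]
    ring
  have hle : ∫ z in UD, |∫ ζ in UD, ‖f ζ‖ * ‖Bker ν z ζ‖ * ν ζ ∂dA| ^ q * ν z ∂dA
      ≤ C ^ q * ∫ z in UD, ‖f z‖ ^ q * ν z ∂dA := by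
    rw [← ENNReal.ofReal_le_ofReal_iff (by positivity)]
    calc _ ≤ ∫⁻ z in UD, ENNReal.ofReal (ν z) *
            ‖∫ ζ in UD, ‖f ζ‖ * ‖Bker ν z ζ‖ * ν ζ ∂dA‖ₑ ^ q ∂dA := by
          rw [← Real.enorm_of_nonneg hX]
          refine (enorm_integral_le_lintegral_enorm _).trans_eq (lintegral_congr fun z => ?_)
          rw [enorm_mul, Real.enorm_of_nonneg (hν.1 z), Real.enorm_rpow_of_nonneg (abs_nonneg _)
            hq0.le, Real.enorm_abs, mul_comm]
      _ ≤ ∫⁻ z in UD, ENNReal.ofReal (ν z) *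
            (∫⁻ ζ, ‖Bker ν z ζ‖ₑ * ‖f ζ‖ₑ ∂(discMeasure ν)) ^ q ∂dA := by
          gcongr with z
          exact hinner z
      _ ≤ ENNReal.ofReal C ^ q * ∫⁻ ζ, ‖f ζ‖ₑ ^ q ∂(discMeasure ν) := by
          rw [← lintegral_discMeasure hν]
          exact hCf _ (hfm.enorm.mono_ac (withDensity_absolutelyContinuous _ _))
      _ = _ := by
          rw [ENNReal.ofReal_mul (by positivity), ENNReal.ofReal_rpow_of_pos hC,
            ofReal_integral_eq_lintegral_ofReal hfi (ae_of_all _ fun z =>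
              mul_nonneg (Real.rpow_nonneg (norm_nonneg _) _) (hν.1 z)),
            lintegral_discMeasure hν]
          congr 1
          refine lintegral_congr fun z => ?_
          rw [ENNReal.ofReal_mul (Real.rpow_nonneg (norm_nonneg _) _),
            ← ENNReal.ofReal_rpow_of_nonneg (norm_nonneg _) hq0.le, ofReal_norm, mul_comm]
  calc _ ≤ (C ^ q * ∫ z in UD, ‖f z‖ ^ q * ν z ∂dA) ^ (1 / q) :=
        Real.rpow_le_rpow hX hle (by positivity)
    _ = C * wnorm q ν f := by
        rw [Real.mul_rpow (by positivity) hY, ← Real.rpow_mul hC.le, mul_one_div_cancel hq0.ne',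
          Real.rpow_one, wnorm]
end
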